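/- arXiv:1607.07069 — 2 statements merged into one kernel-verified Lean document; each statement's English description precedes it below -/
import Mathlib

section
/- Fix d ≥ 2 and let Y = Y_d(n,p). If p ≥ 80·d·log n / n, then w.h.p. H_{d−1}(Y, ℤ) = 0. -/
open MeasureTheory Filter Finset Matrix

noncomputable section

/-- Bernoulli measure on `Bool` with success probability `p` (clamped to `[0,1]`). -/
def bernoulliBool (p : ℝ) : Measure Bool :=
  ENNReal.ofReal (max 0 (min p 1)) • Measure.dirac true +
    ENNReal.ofReal (1 - max 0 (min p 1)) • Measure.dirac false

instance (p : ℝ) : IsFiniteMeasure (bernoulliBool p) := by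
  constructor
  simp only [bernoulliBool, Measure.add_apply, Measure.smul_apply, smul_eq_mul,
    measure_univ, mul_one]
  exact ENNReal.add_lt_top.mpr ⟨ENNReal.ofReal_lt_top, ENNReal.ofReal_lt_top⟩

/-- Index type for potential `d`-dimensional faces on vertex set `Fin n`:
the `(d+1)`-element subsets. -/
abbrev FaceIdx (n d : ℕ) : Type := {s : Finset (Fin n) // s.card = d + 1}

/-- The distribution of the random `d`-complex `Y_d(n,p)`: each potential `d`-face
gets an independent Bernoulli(`p`) coin. (For `d = 1` this is the Erdős–Rényi model
`G(n,p)`.) -/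
def YMeasure (n d : ℕ) (p : ℝ) : Measure (FaceIdx n d → Bool) :=
  Measure.pi fun _ => bernoulliBool p

/-- The random `d`-complex: all faces of dimension `≤ d - 1` (i.e. all subsets of
cardinality `≤ d`, including `∅`, so that degree-0 homology below is reduced
homology), together with the chosen `d`-faces. -/
def Ycomplex (n d : ℕ) (ω : FaceIdx n d → Bool) : Finset (Finset (Fin n)) :=
  Finset.univ.filter fun s => s.card ≤ d ∨ ∃ h : s.card = d + 1, ω ⟨s, h⟩ = true

/-- The Erdős–Rényi random graph associated to a configuration of edge coins. -/
def graphOf (n : ℕ) (ω : FaceIdx n 1 → Bool) : SimpleGraph (Fin n) where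
  Adj i j := i ≠ j ∧ ∃ e : FaceIdx n 1, ω e = true ∧ i ∈ e.1 ∧ j ∈ e.1
  symm := ⟨fun i j ⟨hne, e, he, hi, hj⟩ => ⟨hne.symm, e, he, hj, hi⟩⟩
  loopless := ⟨fun i ⟨hne, _⟩ => hne rfl⟩

instance (n : ℕ) (ω : FaceIdx n 1 → Bool) : DecidableRel (graphOf n ω).Adj :=
  fun i j =>
    inferInstanceAs (Decidable (i ≠ j ∧ ∃ e : FaceIdx n 1, ω e = true ∧ i ∈ e.1 ∧ j ∈ e.1))

/-- The clique complex of the graph determined by the edge coins `ω`: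
faces are vertex sets of complete subgraphs (including `∅` and singletons). -/
def cliqueComplex (n : ℕ) (ω : FaceIdx n 1 → Bool) : Finset (Finset (Fin n)) :=
  Finset.univ.filter fun s => ∀ i ∈ s, ∀ j ∈ s, i ≠ j → (graphOf n ω).Adj i j

/-- The group of simplicial `G`-chains of a complex `K`, in cardinality `c`
(i.e. dimension `c - 1`): functions on the faces of `K` of cardinality `c`. -/
abbrev Chains {V : Type} [Fintype V] [DecidableEq V]
    (K : Finset (Finset V)) (c : ℕ) (G : Type) : Type :=
  {s : Finset V // s ∈ K ∧ s.card = c} → G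

/-- The simplicial boundary map, from chains of cardinality `c+1` to chains of
cardinality `c`, with the usual alternating signs coming from the linear order
on the vertices. -/
def chainBoundary {V : Type} [Fintype V] [DecidableEq V] [LinearOrder V]
    (K : Finset (Finset V)) (c : ℕ) {G : Type} [AddCommGroup G]
    (f : Chains K (c + 1) G) : Chains K c G :=
  fun τ => ∑ v : V,
    if h : v ∉ τ.1 ∧ insert v τ.1 ∈ K then
      ((-1 : ℤ) ^ (τ.1.filter (fun u => u < v)).card) •
        f ⟨insert v τ.1, h.2, by rw [Finset.card_insert_of_notMem h.1, τ.2.2]⟩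
    else 0

/-- Vanishing of the simplicial homology of `K` with coefficients in `G` in
degree `i` (faces of cardinality `i+1`): every cycle is a boundary.
If `∅ ∈ K` this is reduced homology (the boundary map to cardinality-0 chains
is the augmentation); in degrees `i ≥ 1` reduced and unreduced homology agree. -/
def HomologyZero {V : Type} [Fintype V] [DecidableEq V] [LinearOrder V]
    (K : Finset (Finset V)) (i : ℕ) (G : Type) [AddCommGroup G] : Prop :=
  ∀ f : Chains K (i + 1) G, chainBoundary K i f = 0 →
    ∃ g : Chains K (i + 2) G, chainBoundary K (i + 1) g = f

/-- Vanishing of top-dimensional homology `H_d(K,G)`, i.e. the kernel of the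
`d`-th boundary map is zero. -/
def TopHomologyZero {V : Type} [Fintype V] [DecidableEq V] [LinearOrder V]
    (K : Finset (Finset V)) (d : ℕ) (G : Type) [AddCommGroup G] : Prop :=
  ∀ f : Chains K (d + 1) G, chainBoundary K d f = 0 → f = 0

/-- The boundary map on real coefficients, as a linear map. -/
def chainBoundaryLin {V : Type} [Fintype V] [DecidableEq V] [LinearOrder V]
    (K : Finset (Finset V)) (c : ℕ) : Chains K (c + 1) ℝ →ₗ[ℝ] Chains K c ℝ where
  toFun := chainBoundary K c
  map_add' f g := by
    funext τ
    simp only [chainBoundary, Pi.add_apply]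
    rw [← Finset.sum_add_distrib]
    refine Finset.sum_congr rfl fun v _ => ?_
    split
    · simp [smul_add]
    · simp
  map_smul' r f := by
    funext τ
    simp only [chainBoundary, Pi.smul_apply, RingHom.id_apply]
    rw [Finset.smul_sum]
    refine Finset.sum_congr rfl fun v _ => ?_
    split
    · exact smul_comm _ _ _
    · simp

/-- The `k`-th Betti number of `K`: the dimension of the `k`-th real simplicial
homology, i.e. of (kernel of `∂_k`) / (image of `∂_{k+1}`). -/
def bettiNumber {V : Type} [Fintype V] [DecidableEq V] [LinearOrder V]
    (K : Finset (Finset V)) (k : ℕ) : ℕ :=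
  Module.finrank ℝ
    (↥(LinearMap.ker (chainBoundaryLin K k)) ⧸
      (LinearMap.range (chainBoundaryLin K (k + 1))).comap
        (LinearMap.ker (chainBoundaryLin K k)).subtype)

/-- The link of a face `σ` in the complex `K`. -/
def linkSet {V : Type} [Fintype V] [DecidableEq V]
    (K : Finset (Finset V)) (σ : Finset V) : Finset (Finset V) :=
  Finset.univ.filter fun τ => τ ∩ σ = ∅ ∧ τ ∪ σ ∈ K

/-- The graph underlying the link of a face `σ`: its vertices are the vertices
of the link, joined when they span an edge of the link. -/
def linkGraph {V : Type} [Fintype V] [DecidableEq V]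
    (K : Finset (Finset V)) (σ : Finset V) :
    SimpleGraph {v : V // {v} ∈ linkSet K σ} where
  Adj a b := a ≠ b ∧ ({a.1, b.1} : Finset V) ∈ linkSet K σ
  symm := ⟨fun a b ⟨hab, h⟩ => ⟨hab.symm, by rwa [Finset.pair_comm]⟩⟩
  loopless := ⟨fun a ⟨hab, _⟩ => hab rfl⟩

instance {V : Type} [Fintype V] [DecidableEq V] (K : Finset (Finset V)) (σ : Finset V) :
    DecidableRel (linkGraph K σ).Adj :=
  fun a b => inferInstanceAs (Decidable (a ≠ b ∧ ({a.1, b.1} : Finset V) ∈ linkSet K σ))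

/-- The normalized Laplacian `I - D^{-1/2} A D^{-1/2}` of a finite graph. -/
def normalizedLaplacian {W : Type} [Fintype W] [DecidableEq W]
    (H : SimpleGraph W) [DecidableRel H.Adj] : Matrix W W ℝ :=
  Matrix.of fun a b =>
    (if a = b then (1 : ℝ) else 0) -
      (if H.Adj a b then 1 / Real.sqrt ((H.degree a : ℝ) * (H.degree b : ℝ)) else 0)

/-- An elementary `d`-collapse step: remove a free `(d-1)`-face `σ` together with
the unique `d`-face `τ` containing it. -/
def CollapseStep {V : Type} [DecidableEq V] (d : ℕ) (K K' : Finset (Finset V)) : Prop :=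
  ∃ σ τ : Finset V, σ ∈ K ∧ τ ∈ K ∧ τ.card = d + 1 ∧ σ ⊆ τ ∧ σ.card = d ∧
    (∀ ρ ∈ K, σ ⊆ ρ → ρ.card = d + 1 → ρ = τ) ∧ K' = K \ {σ, τ}

/-- `K` is `d`-collapsible if some finite sequence of elementary collapses reduces it
to a complex of dimension at most `d-1`. -/
def IsDCollapsible {V : Type} [DecidableEq V] (d : ℕ) (K : Finset (Finset V)) : Prop :=
  ∃ K' : Finset (Finset V),
    Relation.ReflTransGen (CollapseStep d) K K' ∧ ∀ s ∈ K', s.card ≤ d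

/-- The geometric realization of a complex on vertex set `Fin n`, inside `ℝ^n`:
the union over the faces of the convex hulls of the corresponding standard
basis vectors. -/
def geomReal (n : ℕ) (K : Finset (Finset (Fin n))) : Set (Fin n → ℝ) :=
  ⋃ σ ∈ K, convexHull ℝ ((fun i => (Pi.single i 1 : Fin n → ℝ)) '' ↑σ)

/-- The boundary of the simplex on the vertex set `τ`, as a chain of cardinality
`c` (to be used with `τ.card = c + 1`): the alternating sum of the `c`-element
subsets of `τ`. -/
def simplexBoundaryChain {V : Type} [Fintype V] [DecidableEq V] [LinearOrder V]
    (K : Finset (Finset V)) (c : ℕ) (τ : Finset V) : Chains K c ℝ :=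
  fun σ => ∑ v ∈ τ,
    if σ.1 = τ.erase v then ((-1 : ℝ) ^ (τ.filter (fun u => u < v)).card) else 0

/-- Index type for the multiparameter model: all potential faces of dimension `≥ 1`. -/
abbrev MultiIdx (n : ℕ) : Type := {s : Finset (Fin n) // 2 ≤ s.card}

/-- The distribution of the multiparameter random complex `X(n; p₁, p₂, …)`:
a potential face of cardinality `i+1` gets an independent Bernoulli(`p i`) coin. -/
def multiMeasure (n : ℕ) (p : ℕ → ℝ) : Measure (MultiIdx n → Bool) :=
  Measure.pi fun t => bernoulliBool (p (t.1.card - 1))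

/-- The multiparameter random complex: a set `s` is a face iff every subset of `s`
of dimension `≥ 1` has its coin turned on (this is exactly the
inductive-by-dimension construction: a face is present iff its coin is on and all
of its boundary faces are present). -/
def multiComplex (n : ℕ) (ω : MultiIdx n → Bool) : Finset (Finset (Fin n)) :=
  Finset.univ.filter fun s => ∀ t : MultiIdx n, t.1 ⊆ s → ω t = true

/-- The Vietoris–Rips complex of the points `pts` at scale `r`. -/
def VRcomplex (n d : ℕ) (pts : Fin n → EuclideanSpace ℝ (Fin d)) (r : ℝ) :
    Finset (Finset (Fin n)) :=
  Finset.univ.filter fun s => ∀ i ∈ s, ∀ j ∈ s, dist (pts i) (pts j) ≤ r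

end

/-- sign of a vertex relative to a set -/
def sg {n : ℕ} (ρ : Finset (Fin n)) (x : Fin n) : ℤ :=
  (-1 : ℤ) ^ (ρ.filter (fun u => u < x)).card

/-- coboundary -/
def cob {n : ℕ} {M : Type} [AddCommGroup M] (φ : Finset (Fin n) → M) (τ : Finset (Fin n)) : M :=
  ∑ w ∈ τ, sg τ w • φ (τ.erase w)

/-- boundary of total functions -/
def bd {n : ℕ} (g : Finset (Fin n) → ℤ) (τ : Finset (Fin n)) : ℤ :=
  ∑ w ∈ τᶜ, sg τ w * g (insert w τ)

lemma sg_mul_self {n : ℕ} (ρ : Finset (Fin n)) (x : Fin n) : sg ρ x * sg ρ x = 1 := by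
  unfold sg; rw [← pow_add, ← two_mul, pow_mul]; simp

lemma sg_ne_zero {n : ℕ} (ρ : Finset (Fin n)) (x : Fin n) : sg ρ x ≠ 0 := by
  unfold sg; exact pow_ne_zero _ (by norm_num)

lemma sg_abs {n : ℕ} (ρ : Finset (Fin n)) (x : Fin n) : |sg ρ x| = 1 := by
  unfold sg; simp

lemma sg_erase_lt {n : ℕ} (ρ : Finset (Fin n)) (x y : Fin n) (hx : x ∈ ρ) (h : x < y) :
    sg (ρ.erase x) y = - sg ρ y := by
  unfold sg
  have : (ρ.filter (fun u => u < y)).card = ((ρ.erase x).filter (fun u => u < y)).card + 1 := by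
    rw [Finset.filter_erase, Finset.card_erase_add_one]
    simp [hx, h]
  rw [this, pow_succ]; ring

lemma sg_erase_ge {n : ℕ} (ρ : Finset (Fin n)) (x y : Fin n) (h : y ≤ x) :
    sg (ρ.erase x) y = sg ρ y := by
  unfold sg
  rw [Finset.filter_erase, Finset.erase_eq_of_notMem]
  simp [h]

lemma sg_insert_self {n : ℕ} (ρ : Finset (Fin n)) (x : Fin n) :
    sg (insert x ρ) x = sg ρ x := by
  unfold sg
  rw [Finset.filter_insert]; simp

lemma sg_swap {n : ℕ} (ρ : Finset (Fin n)) (x y : Fin n) (hx : x ∈ ρ) (hy : y ∈ ρ) (h : x ≠ y) :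
    sg ρ x * sg (ρ.erase x) y = - (sg ρ y * sg (ρ.erase y) x) := by
  rcases lt_or_gt_of_ne h with h | h
  · rw [sg_erase_lt ρ x y hx h, sg_erase_ge ρ y x h.le]; ring
  · rw [sg_erase_lt ρ y x hy h, sg_erase_ge ρ x y h.le]; ring

lemma sg_swap' {n : ℕ} (ρ : Finset (Fin n)) (x y : Fin n) (hx : x ∉ ρ) (hy : y ∉ ρ) (h : x ≠ y) :
    sg ρ x * sg (insert x ρ) y = - (sg ρ y * sg (insert y ρ) x) := by
  have := sg_swap (insert x (insert y ρ)) x y (by simp) (by simp) h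
  have e1 : (insert x (insert y ρ)).erase x = insert y ρ := by
    rw [Finset.erase_insert]; simp [h, hx]
  have e2 : (insert x (insert y ρ)).erase y = insert x ρ := by
    rw [Finset.insert_comm, Finset.erase_insert]; simp [h.symm, hy]
  rw [e1, e2, sg_insert_self, sg_insert_self, Finset.insert_comm, sg_insert_self, sg_insert_self] at this
  have a1 := sg_mul_self ρ x
  have a2 := sg_mul_self ρ y
  linear_combination this

lemma cob_cob {n : ℕ} {M : Type} [AddCommGroup M] (φ : Finset (Fin n) → M) (ρ : Finset (Fin n)) :
    cob (cob φ) ρ = 0 := by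
  unfold cob
  simp_rw [Finset.smul_sum, smul_smul]
  rw [Finset.sum_sigma']
  refine Finset.sum_involution (fun a _ => ⟨a.2, a.1⟩) ?_ ?_ ?_ ?_
  · rintro ⟨x, y⟩ h
    simp only [Finset.mem_sigma, Finset.mem_erase] at h
    obtain ⟨hx, hyx, hy⟩ := h
    dsimp only
    rw [sg_swap ρ x y hx hy hyx.symm, Finset.erase_right_comm, ← add_smul]
    simp
  · rintro ⟨x, y⟩ h _ h2
    simp only [Finset.mem_sigma, Finset.mem_erase] at h
    simp only [Sigma.mk.injEq, heq_eq_eq] at h2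
    exact h.2.1 h2.1
  · rintro ⟨x, y⟩ h
    simp only [Finset.mem_sigma, Finset.mem_erase] at h ⊢
    exact ⟨h.2.2, h.2.1.symm, h.1⟩
  · rintro ⟨x, y⟩ h
    rfl

lemma bd_bd {n : ℕ} (g : Finset (Fin n) → ℤ) (ρ : Finset (Fin n)) :
    bd (bd g) ρ = 0 := by
  unfold bd
  simp_rw [Finset.mul_sum, ← mul_assoc]
  rw [Finset.sum_sigma']
  refine Finset.sum_involution (fun a _ => ⟨a.2, a.1⟩) ?_ ?_ ?_ ?_
  · rintro ⟨x, y⟩ h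
    simp only [Finset.mem_sigma, Finset.mem_compl, Finset.mem_insert, not_or] at h
    obtain ⟨hx, hyx, hy⟩ := h
    dsimp only
    rw [sg_swap' ρ x y hx hy (Ne.symm hyx), Finset.insert_comm]
    ring
  · rintro ⟨x, y⟩ h _ h2
    simp only [Finset.mem_sigma, Finset.mem_compl, Finset.mem_insert, not_or] at h
    simp only [Sigma.mk.injEq, heq_eq_eq] at h2
    exact h.2.1 h2.1
  · rintro ⟨x, y⟩ h
    simp only [Finset.mem_sigma, Finset.mem_compl, Finset.mem_insert, not_or] at h ⊢
    exact ⟨h.2.2, Ne.symm h.2.1, h.1⟩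
  · rintro ⟨x, y⟩ h
    rfl

lemma map_cob {n : ℕ} {M M' : Type} [AddCommGroup M] [AddCommGroup M'] (h : M →+ M')
    (φ : Finset (Fin n) → M) (τ : Finset (Fin n)) :
    h (cob φ τ) = cob (fun σ => h (φ σ)) τ := by
  unfold cob
  simp [map_sum, map_zsmul]

/-- total extension of a chain -/
noncomputable def ext0 {n : ℕ} (K : Finset (Finset (Fin n))) (c : ℕ) (f : Chains K c ℤ) :
    Finset (Fin n) → ℤ := fun s => if h : s ∈ K ∧ s.card = c then f ⟨s, h⟩ else 0

lemma chainBoundary_eq {n : ℕ} (K : Finset (Finset (Fin n))) (c : ℕ) (f : Chains K (c+1) ℤ)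
    (τ : {s : Finset (Fin n) // s ∈ K ∧ s.card = c}) :
    chainBoundary K c f τ = bd (ext0 K (c+1) f) τ.1 := by
  unfold chainBoundary bd
  rw [← Finset.sum_filter_add_sum_filter_not Finset.univ (fun v => v ∉ τ.1)]
  rw [Finset.sum_eq_zero (s := Finset.univ.filter (fun v => ¬ (v ∉ τ.1))), add_zero]
  · apply Finset.sum_congr
    · ext; simp
    · intro v hv
      simp only [Finset.mem_compl] at hv
      have hc : (insert v τ.1).card = c + 1 := by rw [Finset.card_insert_of_notMem hv, τ.2.2]
      by_cases h : insert v τ.1 ∈ K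
      · rw [dif_pos ⟨hv, h⟩]
        unfold ext0
        rw [dif_pos ⟨h, hc⟩]
        simp [sg]
      · rw [dif_neg (by tauto)]
        unfold ext0
        rw [dif_neg (by tauto)]; simp
  · intro v hv
    rw [dif_neg]
    simp at hv; tauto

/-- `Y` is bad over `F`: there is a nontrivial cocycle -/
def Bad (n d : ℕ) (F : Type) [AddCommGroup F] (Y : FaceIdx n d → Bool) : Prop :=
  ∃ φ : Finset (Fin n) → F, (∀ τ : FaceIdx n d, Y τ = true → cob φ τ.1 = 0) ∧
    ∃ τ : FaceIdx n d, cob φ τ.1 ≠ 0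

lemma Bad.mono {n d : ℕ} {F : Type} [AddCommGroup F] {Y Y' : FaceIdx n d → Bool}
    (h : ∀ τ, Y τ = true → Y' τ = true) (hb : Bad n d F Y') : Bad n d F Y := by
  obtain ⟨φ, h1, h2⟩ := hb
  exact ⟨φ, fun τ hτ => h1 τ (h τ hτ), h2⟩

/-- `d`-sets avoiding `v` -/
abbrev Dv (n d : ℕ) (v : Fin n) : Type := {σ : Finset (Fin n) // σ.card = d ∧ v ∉ σ}

/-- unit vectors -/
def ev {n d : ℕ} {v : Fin n} (R : Type) [Ring R] (ρ : Finset (Fin n)) : Dv n d v → R :=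
  fun σ => if σ.1 = ρ then 1 else 0

lemma ev_mem {n d : ℕ} {v : Fin n} (R : Type) [Ring R] (ρ : Finset (Fin n)) (h : v ∈ ρ) :
    (ev R ρ : Dv n d v → R) = 0 := by
  funext σ
  simp only [ev, Pi.zero_apply, ite_eq_right_iff]
  intro h2; exact absurd (h2 ▸ h) σ.2.2

lemma ev_single {n d : ℕ} {v : Fin n} (R : Type) [Ring R] (σ : Dv n d v) :
    (ev R σ.1 : Dv n d v → R) = Pi.single σ 1 := by
  funext σ'
  simp only [ev, Pi.single_apply, Subtype.ext_iff]

lemma cob_star {n : ℕ} {M : Type} [AddCommGroup M] (v : Fin n) (φ : Finset (Fin n) → M)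
    (hφ : ∀ ρ, v ∈ ρ → φ ρ = 0) (σ : Finset (Fin n)) (hσ : v ∉ σ) :
    cob φ (insert v σ) = sg σ v • φ σ := by
  unfold cob
  rw [Finset.sum_insert hσ, Finset.sum_eq_zero, add_zero, sg_insert_self, Finset.erase_insert hσ]
  intro w hw
  rw [hφ, smul_zero]
  rw [Finset.mem_erase]
  refine ⟨?_, by simp⟩
  rintro rfl; exact hσ hw

/-- masked boundary as linear map -/
def Gmap {n d : ℕ} (v : Fin n) (Y : FaceIdx n d → Bool) :
    (Finset (Fin n) → ℤ) →ₗ[ℤ] (Dv n d v → ℤ) where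
  toFun g := fun σ => bd (fun s => if h : s.card = d + 1 then (if Y ⟨s, h⟩ = true then g s else 0) else 0) σ.1
  map_add' f g := by
    funext σ
    simp only [bd, Pi.add_apply, ← Finset.sum_add_distrib]
    refine Finset.sum_congr rfl fun w _ => ?_
    split_ifs <;> ring
  map_smul' r f := by
    funext σ
    simp only [bd, Pi.smul_apply, smul_eq_mul, RingHom.id_apply, Finset.mul_sum]
    refine Finset.sum_congr rfl fun w _ => ?_
    split_ifs <;> ring

lemma Gmap_single {n d : ℕ} (v : Fin n) (Y : FaceIdx n d → Bool) (τ : FaceIdx n d)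
    (hτ : Y τ = true) : Gmap v Y (Pi.single τ.1 1) = cob (ev ℤ) τ.1 := by
  funext σ
  simp only [Gmap, LinearMap.coe_mk, AddHom.coe_mk, bd, cob, Finset.sum_apply, Pi.smul_apply,
    smul_eq_mul, ev]
  have e1 : ∀ w ∈ σ.1ᶜ, sg σ.1 w * (if h : (insert w σ.1).card = d + 1 then (if Y ⟨insert w σ.1, h⟩ = true
      then (Pi.single τ.1 1 : Finset (Fin n) → ℤ) (insert w σ.1) else 0) else 0) =
      if w ∈ τ.1 ∧ σ.1 = τ.1.erase w then sg τ.1 w else 0 := by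
    intro w hw
    rw [Finset.mem_compl] at hw
    have hc : (insert w σ.1).card = d + 1 := by rw [Finset.card_insert_of_notMem hw, σ.2.1]
    rw [dif_pos hc]
    by_cases h : insert w σ.1 = τ.1
    · have h2 : (⟨insert w σ.1, hc⟩ : FaceIdx n d) = τ := Subtype.ext h
      rw [if_pos (by rw [h2]; exact hτ), h, Pi.single_eq_same, if_pos, ← h, sg_insert_self, mul_one]
      rw [← h]; simp [Finset.erase_insert hw]
    · have hn : ¬ (w ∈ τ.1 ∧ σ.1 = τ.1.erase w) := by
        rintro ⟨h1, h2⟩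
        exact h (by rw [h2, Finset.insert_erase h1])
      rw [Pi.single_eq_of_ne h, if_neg hn]
      simp
  rw [Finset.sum_congr rfl e1]
  rw [← Finset.sum_filter]
  simp only [mul_ite, mul_one, mul_zero]
  rw [← Finset.sum_filter]
  refine Finset.sum_congr ?_ fun _ _ => rfl
  ext w
  simp only [Finset.mem_filter, Finset.mem_compl]
  constructor
  · rintro ⟨_, h⟩; exact h
  · rintro ⟨h1, h2⟩
    refine ⟨?_, h1, h2⟩
    rw [h2]; simp

lemma Gmap_surj {n d : ℕ} (v : Fin n) (Y : FaceIdx n d → Bool)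
    (h : ∀ q : ℕ, q.Prime → ¬ Bad n d (ZMod q) Y) : LinearMap.range (Gmap v Y) = ⊤ := by
  rcases eq_top_or_exists_le_coatom (LinearMap.range (Gmap v Y)) with h1 | ⟨m, hm, hle⟩
  · exact h1
  exfalso
  have hs := isSimpleModule_iff_isCoatom.mpr hm
  obtain ⟨I, hI, ⟨e⟩⟩ := isSimpleModule_iff_quot_maximal.mp hs
  obtain ⟨a, ha⟩ : ∃ a : ℤ, I = Ideal.span {a} := ⟨_, (Ideal.span_singleton_generator I).symm⟩
  let q := a.natAbs
  have haq : I = Ideal.span {(q : ℤ)} := by rw [ha]; simp [q]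
  have hq : q.Prime := by
    have hne : I ≠ ⊥ := by
      rintro rfl
      have : IsField ℤ := by
        exact Ring.isField_iff_maximal_bot.mpr hI
      exact Int.not_isField this
    have hpr : I.IsPrime := hI.isPrime
    rw [haq] at hpr hne
    rw [Ideal.span_singleton_prime (by simpa [Ideal.span_singleton_eq_bot] using hne)] at hpr
    exact Nat.prime_iff_prime_int.mpr hpr
  subst haq
  let H : (Dv n d v → ℤ) →+ ZMod q :=
    ((Int.quotientSpanNatEquivZMod q).toAddEquiv.toAddMonoidHom).comp
      ((e.toLinearMap.toAddMonoidHom).comp (m.mkQ.toAddMonoidHom))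
  have Hz : ∀ x, H x = 0 ↔ x ∈ m := by
    intro x
    simp [H]
  apply h q hq
  refine ⟨fun σ => H (ev ℤ σ), ?_, ?_⟩
  · intro τ hτ
    rw [← map_cob, ← Gmap_single v Y τ hτ, Hz]
    exact hle ⟨_, rfl⟩
  · by_contra hcon
    push Not at hcon
    apply hm.1
    rw [eq_top_iff, ← (Pi.basisFun ℤ (Dv n d v)).span_eq, Submodule.span_le]
    rintro _ ⟨σ, rfl⟩
    rw [Pi.basisFun_apply, ← ev_single, SetLike.mem_coe, ← Hz]
    have := hcon ⟨insert v σ.1, by rw [Finset.card_insert_of_notMem σ.2.2, σ.2.1]⟩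
    rw [cob_star v _ (fun ρ hρ => by rw [ev_mem ℤ ρ hρ, map_zero]) _ σ.2.2] at this
    have h2 := congrArg (fun x => sg σ.1 v • x) this
    rwa [smul_smul, sg_mul_self, one_smul, smul_zero] at h2

lemma bd_sub {n : ℕ} (f g : Finset (Fin n) → ℤ) (ρ : Finset (Fin n)) :
    bd (fun s => f s - g s) ρ = bd f ρ - bd g ρ := by
  simp [bd, mul_sub, Finset.sum_sub_distrib]

lemma homologyZero_of_not_bad {n d : ℕ} (hd : 1 ≤ d) (v : Fin n) (Y : FaceIdx n d → Bool)
    (h : ∀ q : ℕ, q.Prime → ¬ Bad n d (ZMod q) Y) :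
    HomologyZero (Ycomplex n d Y) (d - 1) ℤ := by
  obtain ⟨m, rfl⟩ : ∃ m, d = m + 1 := ⟨d - 1, by omega⟩
  simp only [Nat.add_sub_cancel]
  generalize hK : Ycomplex n (m+1) Y = K
  intro f hf
  have hKlow : ∀ s : Finset (Fin n), s.card ≤ m + 1 → s ∈ K := by
    intro s hs; simp [← hK, Ycomplex, hs]
  obtain ⟨g, hg⟩ : (fun σ : Dv n (m+1) v => ext0 K (m+1) f σ.1) ∈ LinearMap.range (Gmap v Y) := by
    rw [Gmap_surj v Y h]; trivial
  refine ⟨fun s => g s.1, ?_⟩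
  set G : Chains K (m+2) ℤ := fun s => g s.1
  have hmask : ext0 K (m+2) G = (fun s => if h : s.card = (m+1) + 1 then (if Y ⟨s, h⟩ = true then g s else 0) else 0) := by
    funext s
    unfold ext0
    by_cases hc : s.card = m + 2
    · rw [dif_pos hc]
      by_cases hy : Y ⟨s, hc⟩ = true
      · rw [if_pos hy, dif_pos]
        refine ⟨?_, hc⟩
        simp [← hK, Ycomplex, hc, hy]
      · rw [if_neg hy, dif_neg]
        rintro ⟨h1, -⟩
        simp [← hK, Ycomplex, hc, hy] at h1
    · rw [dif_neg hc, dif_neg]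
      tauto
  let r : Finset (Fin n) → ℤ := fun s => ext0 K (m+1) f s - bd (ext0 K (m+2) G) s
  have hr1 : ∀ σ : Finset (Fin n), σ.card = m + 1 → v ∉ σ → r σ = 0 := by
    intro σ h1 h2
    have := congrFun hg ⟨σ, h1, h2⟩
    simp only [Gmap, LinearMap.coe_mk, AddHom.coe_mk] at this
    simp only [r, hmask, this, sub_self]
  have hr2 : ∀ ρ : Finset (Fin n), ρ.card = m → bd r ρ = 0 := by
    intro ρ hρ
    simp only [r]
    rw [bd_sub, bd_bd, sub_zero]
    have := congrFun hf ⟨ρ, hKlow ρ (by omega), hρ⟩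
    rw [chainBoundary_eq] at this
    exact this
  have hr3 : ∀ σ : Finset (Fin n), σ.card = m + 1 → r σ = 0 := by
    intro σ h1
    by_cases hv : v ∈ σ
    · have hc : (σ.erase v).card = m := by rw [Finset.card_erase_of_mem hv]; omega
      have := hr2 (σ.erase v) hc
      unfold bd at this
      rw [Finset.sum_eq_single v] at this
      · rw [Finset.insert_erase hv] at this
        exact (mul_eq_zero.mp this).resolve_left (sg_ne_zero _ _)
      · intro w hw hwv
        rw [Finset.mem_compl] at hw
        rw [hr1, mul_zero]
        · rw [Finset.card_insert_of_notMem hw, hc]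
        · simp [Ne.symm hwv]
      · simp
    · exact hr1 σ h1 hv
  funext τ
  rw [chainBoundary_eq]
  have := hr3 τ.1 τ.2.2
  have h2 : ext0 K (m+1) f τ.1 = f τ := by unfold ext0; rw [dif_pos τ.2]
  change bd (ext0 K (m+2) G) τ.1 = f τ
  simp only [r] at this
  linarith

lemma cob_ev_abs {n d : ℕ} {v : Fin n} (τ : Finset (Fin n)) (σ : Dv n d v) :
    |(cob (ev ℤ) τ : Dv n d v → ℤ) σ| ≤ 1 := by
  simp only [cob, Finset.sum_apply, Pi.smul_apply, smul_eq_mul, ev, mul_ite, mul_one, mul_zero]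
  rw [← Finset.sum_filter]
  refine (Finset.abs_sum_le_sum_abs _ _).trans ?_
  simp only [sg_abs, Finset.sum_const, nsmul_eq_mul, mul_one]
  norm_cast
  rw [Finset.card_le_one]
  intro a ha b hb
  simp only [Finset.mem_filter] at ha hb
  by_contra hab
  have : a ∈ τ.erase b := by simp [hab, ha.1]
  rw [← hb.2, ha.2] at this
  simp at this

lemma cob_ev_cast {n d : ℕ} {v : Fin n} (q : ℕ) (τ : Finset (Fin n)) (σ : Dv n d v) :
    (cob (ev (ZMod q)) τ : Dv n d v → ZMod q) σ = (((cob (ev ℤ) τ : Dv n d v → ℤ) σ : ℤ) : ZMod q) := by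
  simp only [cob, Finset.sum_apply, Pi.smul_apply, Int.cast_sum]
  refine Finset.sum_congr rfl fun w _ => ?_
  simp only [ev]
  split_ifs <;> simp

lemma cob_congr {n d : ℕ} {M : Type} [AddCommGroup M] (φ ψ : Finset (Fin n) → M)
    (h : ∀ σ, σ.card = d → φ σ = ψ σ) (τ : Finset (Fin n)) (hτ : τ.card = d + 1) :
    cob φ τ = cob ψ τ := by
  unfold cob
  refine Finset.sum_congr rfl fun w hw => ?_
  rw [h]
  rw [Finset.card_erase_of_mem hw, hτ]; simp

/-- normalization of a cocycle at `v` -/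
def nrm {n : ℕ} {M : Type} [AddCommGroup M] (v : Fin n) (c : Finset (Fin n) → M)
    (σ : Finset (Fin n)) : M := if v ∈ σ then 0 else sg σ v • c (insert v σ)

lemma cob_nrm {n : ℕ} {M : Type} [AddCommGroup M] (v : Fin n) (c : Finset (Fin n) → M)
    (hc : ∀ ρ, cob c ρ = 0) (τ : Finset (Fin n)) : cob (nrm v c) τ = c τ := by
  by_cases hv : v ∈ τ
  · have := cob_star v (nrm v c) (fun ρ hρ => by simp [nrm, hρ]) (τ.erase v) (by simp)
    rw [Finset.insert_erase hv] at this
    rw [this]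
    simp only [nrm, Finset.mem_erase, ne_eq, not_true_eq_false, false_and, if_false]
    rw [smul_smul, sg_mul_self, one_smul, Finset.insert_erase hv]
  · have h := hc (insert v τ)
    unfold cob at h
    rw [Finset.sum_insert hv, Finset.erase_insert hv] at h
    have h2 : sg (insert v τ) v • cob (nrm v c) τ =
      - ∑ x ∈ τ, sg (insert v τ) x • c ((insert v τ).erase x) := by
      unfold cob
      rw [Finset.smul_sum, ← Finset.sum_neg_distrib]
      refine Finset.sum_congr rfl fun w hw => ?_
      have hwv : w ≠ v := by rintro rfl; exact hv hw
      have e : (insert v τ).erase w = insert v (τ.erase w) := by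
        rw [Finset.erase_insert_of_ne hwv.symm]
      have := sg_swap (insert v τ) v w (by simp) (by simp [hw]) hwv.symm
      rw [Finset.erase_insert hv, e, sg_insert_self (τ.erase w)] at this
      simp only [nrm, Finset.mem_erase, hv, and_false, if_false]
      rw [smul_smul, smul_smul, this, e, neg_mul, mul_assoc, sg_mul_self, mul_one, neg_smul]
    have h3 : sg (insert v τ) v • cob (nrm v c) τ = sg (insert v τ) v • c τ := by
      rw [h2]; exact (eq_neg_of_add_eq_zero_left h).symm
    have h4 := congrArg (fun x => sg (insert v τ) v • x) h3
    rwa [smul_smul, smul_smul, sg_mul_self, one_smul, one_smul] at h4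

lemma cob_eq_sum {n d : ℕ} {q : ℕ} (v : Fin n) (φ : Finset (Fin n) → ZMod q)
    (hφ : ∀ ρ, v ∈ ρ → φ ρ = 0) (τ : FaceIdx n d) :
    cob φ τ.1 = ∑ σ : Dv n d v, (cob (ev ℤ) τ.1 : Dv n d v → ℤ) σ * φ σ.1 := by
  simp_rw [← cob_ev_cast]
  simp only [cob, Finset.sum_apply, Pi.smul_apply, Finset.sum_mul]
  rw [Finset.sum_comm]
  refine Finset.sum_congr rfl fun w hw => ?_
  by_cases hv : v ∈ τ.1.erase w
  · rw [hφ _ hv, smul_zero, Finset.sum_eq_zero]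
    intro σ _
    rw [ev_mem _ _ hv]; simp
  · have hc : (τ.1.erase w).card = d := by rw [Finset.card_erase_of_mem hw, τ.2]; simp
    rw [Finset.sum_eq_single (⟨τ.1.erase w, hc, hv⟩ : Dv n d v)]
    · simp [ev]
    · intro σ _ hσ
      have : σ.1 ≠ τ.1.erase w := fun h => hσ (Subtype.ext h)
      simp [ev, this]
    · simp

lemma card_Dv {n d : ℕ} (v : Fin n) : Fintype.card (Dv n d v) ≤ n ^ d := by
  have h1 : Fintype.card (Dv n d v) ≤ Fintype.card {σ : Finset (Fin n) // σ.card = d} := by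
    apply Fintype.card_le_of_injective (fun σ => (⟨σ.1, σ.2.1⟩ : {σ : Finset (Fin n) // σ.card = d}))
    intro a b h
    exact Subtype.ext (Subtype.mk.inj h)
  refine h1.trans ?_
  rw [Fintype.card_finset_len, Fintype.card_fin]
  exact Nat.choose_le_pow n d

lemma bad_primes {n d : ℕ} (v : Fin n) (Y : FaceIdx n d → Bool) (h2 : ¬ Bad n d (ZMod 2) Y) :
    ∃ Q : Finset ℕ, Q.card ≤ n ^ (2 * d) ∧ ∀ q : ℕ, q.Prime → Bad n d (ZMod q) Y → q ∈ Q := by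
  have : Fact (Nat.Prime 2) := ⟨Nat.prime_two⟩
  let a : {τ : FaceIdx n d // Y τ = true} → (Dv n d v → ZMod 2) := fun τ => cob (ev (ZMod 2)) τ.1.1
  have hspan : Submodule.span (ZMod 2) (Set.range a) = ⊤ := by
    by_contra hne
    obtain ⟨f, hf, hle⟩ := Submodule.exists_le_ker_of_lt_top _ (lt_top_iff_ne_top.mpr hne)
    apply h2
    refine ⟨fun σ => f (ev (ZMod 2) σ), ?_, ?_⟩
    · intro τ hτ
      have := map_cob f.toAddMonoidHom (ev (ZMod 2)) τ.1
      refine this.symm.trans ?_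
      exact hle (Submodule.subset_span ⟨⟨τ, hτ⟩, rfl⟩)
    · by_contra hcon
      push Not at hcon
      apply hf
      apply (Pi.basisFun (ZMod 2) (Dv n d v)).ext
      intro σ
      rw [Pi.basisFun_apply, ← ev_single]
      have := hcon ⟨insert v σ.1, by rw [Finset.card_insert_of_notMem σ.2.2, σ.2.1]⟩
      rw [cob_star v _ (fun ρ hρ => by rw [ev_mem _ ρ hρ, map_zero]) _ σ.2.2] at this
      have h2 := congrArg (fun x => sg σ.1 v • x) this
      rwa [smul_smul, sg_mul_self, one_smul, smul_zero] at h2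
  obtain ⟨κ, b, hb, hsp, hli⟩ := exists_linearIndependent' (ZMod 2) a
  rw [hspan] at hsp
  let B := Module.Basis.mk hli (by rw [hsp])
  let e : Dv n d v ≃ κ := (Pi.basisFun (ZMod 2) (Dv n d v)).indexEquiv B
  let M : Matrix (Dv n d v) (Dv n d v) ℤ := Matrix.of fun i => cob (ev ℤ) (b (e i)).1.1
  have hMij : ∀ i j, M i j = (cob (ev ℤ) (b (e i)).1.1 : Dv n d v → ℤ) j := fun _ _ => rfl
  have hM2 : ((M.det : ℤ) : ZMod 2) ≠ 0 := by
    have h3 : LinearIndependent (ZMod 2) (M.map (Int.cast : ℤ → ZMod 2)).row := by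
      have := hli.comp e e.injective
      have he : (M.map (Int.cast : ℤ → ZMod 2)).row = (a ∘ b) ∘ e := by
        funext i j
        simp only [Matrix.row, Matrix.map_apply, Function.comp, hMij, a]
        rw [cob_ev_cast]
      rw [he]; exact this
    rw [Matrix.linearIndependent_rows_iff_isUnit, Matrix.isUnit_iff_isUnit_det] at h3
    have h4 := h3.ne_zero
    have : ((M.det : ℤ) : ZMod 2) = (M.map (Int.cast : ℤ → ZMod 2)).det := by
      exact (Int.castRingHom (ZMod 2)).map_det M
    rwa [this]
  have hM : M.det ≠ 0 := by
    intro h; rw [h] at hM2; simp at hM2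
  refine ⟨M.det.natAbs.primeFactors, ?_, ?_⟩
  · set R := Fintype.card (Dv n d v)
    have hdet : |M.det| ≤ (R.factorial : ℤ) := by
      have := Matrix.det_le (A := M) (abv := AbsoluteValue.abs) (x := (1 : ℤ)) (fun i j => cob_ev_abs _ _)
      simpa using this
    have hnat : M.det.natAbs ≤ R.factorial := by
      have : ((M.det.natAbs : ℕ) : ℤ) ≤ R.factorial := by rw [Int.natCast_natAbs]; exact hdet
      exact_mod_cast this
    have hpow : 2 ^ (M.det.natAbs.primeFactors.card) ≤ M.det.natAbs := by
      calc 2 ^ (M.det.natAbs.primeFactors.card) ≤ ∏ p ∈ M.det.natAbs.primeFactors, p :=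
            Finset.pow_card_le_prod _ _ _ (fun p hp => (Nat.prime_of_mem_primeFactors hp).two_le)
        _ ≤ _ := Nat.le_of_dvd (Int.natAbs_pos.mpr hM) (Nat.prod_primeFactors_dvd _)
    have hR : R.factorial ≤ 2 ^ (R * R) := by
      calc R.factorial ≤ R ^ R := Nat.factorial_le_pow R
        _ ≤ (2 ^ R) ^ R := Nat.pow_le_pow_left Nat.lt_two_pow_self.le R
        _ = 2 ^ (R * R) := by rw [pow_mul]
    have hcard := (Nat.pow_le_pow_iff_right (by norm_num : 1 < 2)).mp (hpow.trans (hnat.trans hR))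
    calc _ ≤ R * R := hcard
      _ ≤ n ^ d * n ^ d := Nat.mul_le_mul (card_Dv v) (card_Dv v)
      _ = n ^ (2 * d) := by rw [two_mul, pow_add]
  · intro q hq hbad
    have : Fact q.Prime := ⟨hq⟩
    rw [Nat.mem_primeFactors]
    refine ⟨hq, ?_, Int.natAbs_ne_zero.mpr hM⟩
    rw [← Int.natCast_dvd, ← ZMod.intCast_zmod_eq_zero_iff_dvd]
    obtain ⟨φ, hφ1, τ0, hφ2⟩ := hbad
    let ψ := nrm v (cob φ)
    have hψ : ∀ τ, cob ψ τ = cob φ τ := cob_nrm v (cob φ) (cob_cob φ)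
    have hψv : ∀ ρ, v ∈ ρ → ψ ρ = 0 := fun ρ hρ => by simp [ψ, nrm, hρ]
    have : ((M.det : ℤ) : ZMod q) = (M.map (Int.cast : ℤ → ZMod q)).det :=
      (Int.castRingHom (ZMod q)).map_det M
    rw [this, ← Matrix.exists_mulVec_eq_zero_iff]
    refine ⟨fun σ => ψ σ.1, ?_, ?_⟩
    · intro h0
      apply hφ2
      rw [← hψ, cob_eq_sum v ψ hψv]
      apply Finset.sum_eq_zero
      intro σ _
      have := congrFun h0 σ
      simp only [Pi.zero_apply] at this
      rw [this, mul_zero]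
    · funext i
      simp only [Matrix.mulVec, dotProduct, Matrix.map_apply, hMij, Pi.zero_apply]
      rw [← cob_eq_sum v ψ hψv, hψ]
      exact hφ1 _ (b (e i)).2

open scoped Classical in
/-- faces containing some member of `K` -/
noncomputable def hitF {n : ℕ} (d : ℕ) (K : Finset (Finset (Fin n))) : Finset (FaceIdx n d) :=
  Finset.univ.filter fun τ => ∃ σ ∈ K, σ ⊆ τ.1

open scoped Classical in
/-- faces containing exactly one member of `K` -/
noncomputable def S1F {n : ℕ} (d : ℕ) (K : Finset (Finset (Fin n))) : Finset (FaceIdx n d) :=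
  Finset.univ.filter fun τ => ∃! σ, σ ∈ K ∧ σ ⊆ τ.1

open scoped Classical in
/-- complement of the flat spanned by `A` relative to `K` -/
noncomputable def WSF {n d : ℕ} (F : Type) [Field F] (K : Finset (Finset (Fin n)))
    (A : Finset (FaceIdx n d)) : Finset (FaceIdx n d) :=
  Finset.univ.filter fun τ => ∃ ψ : Finset (Fin n) → F, (∀ σ, σ ∉ K → ψ σ = 0) ∧
    (∀ τ' ∈ A, cob ψ τ'.1 = 0) ∧ cob ψ τ.1 ≠ 0

lemma sg_smul_eq_zero {n : ℕ} {M : Type} [AddCommGroup M] (ρ : Finset (Fin n)) (x : Fin n) (m : M)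
    (h : sg ρ x • m = 0) : m = 0 := by
  have h2 := congrArg (fun y => sg ρ x • y) h
  rwa [smul_smul, sg_mul_self, one_smul, smul_zero] at h2

/-- evaluation functional -/
noncomputable def Lfun {n : ℕ} (F : Type) [Field F] (K : Finset (Finset (Fin n)))
    (τ : Finset (Fin n)) : ({x // x ∈ K} → F) →ₗ[F] F where
  toFun x := cob (fun σ => if h : σ ∈ K then x ⟨σ, h⟩ else 0) τ
  map_add' x y := by
    simp only [cob, ← Finset.sum_add_distrib]
    refine Finset.sum_congr rfl fun w _ => ?_
    split_ifs <;> simp [smul_add]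
  map_smul' r x := by
    simp only [cob, RingHom.id_apply, Finset.smul_sum]
    refine Finset.sum_congr rfl fun w _ => ?_
    split_ifs <;> simp [mul_left_comm]

lemma exists_basis_faces {n d : ℕ} (F : Type) [Field F] (K : Finset (Finset (Fin n)))
    (hKd : ∀ σ ∈ K, σ.card = d) (Y : FaceIdx n d → Bool) :
    ∃ A : Finset (FaceIdx n d), A ⊆ hitF d K ∧ A.card ≤ K.card ∧ (∀ τ ∈ A, Y τ = true) ∧
      (∀ τ ∈ WSF F K A, Y τ = false) := by
  classical
  let L : {τ : FaceIdx n d // Y τ = true} → (({x // x ∈ K} → F) →ₗ[F] F) := fun τ => Lfun F K τ.1.1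
  obtain ⟨κ, a, ha, hsp, hli⟩ := exists_linearIndependent' F L
  have : Finite κ := Finite.of_injective a ha
  have : Fintype κ := Fintype.ofFinite κ
  refine ⟨Finset.univ.image (fun i => (a i).1), ?_, ?_, ?_, ?_⟩
  · intro τ hτ
    simp only [Finset.mem_image, Finset.mem_univ, true_and] at hτ
    obtain ⟨i, rfl⟩ := hτ
    have hne := hli.ne_zero i
    simp only [hitF, Finset.mem_filter, Finset.mem_univ, true_and]
    by_contra hcon
    push Not at hcon
    apply hne
    ext x
    simp only [Function.comp, L, Lfun, cob, LinearMap.comp_apply, LinearMap.coe_mk, AddHom.coe_mk,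
      LinearMap.zero_apply]
    apply Finset.sum_eq_zero
    intro w hw
    rw [dif_neg, smul_zero]
    intro hmem
    exact hcon _ hmem (Finset.erase_subset _ _)
  · refine Finset.card_image_le.trans ?_
    have h1 := hli.fintype_card_le_finrank
    rw [Finset.card_univ]
    refine h1.trans ?_
    have : Module.finrank F (({x // x ∈ K} → F) →ₗ[F] F) = Module.finrank F ({x // x ∈ K} → F) :=
      Subspace.dual_finrank_eq
    rw [this]
    simp
  · intro τ hτ
    simp only [Finset.mem_image, Finset.mem_univ, true_and] at hτ
    obtain ⟨i, rfl⟩ := hτ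
    exact (a i).2
  · intro τ hτ
    simp only [WSF, Finset.mem_filter, Finset.mem_univ, true_and] at hτ
    obtain ⟨ψ, h0, hA, hne⟩ := hτ
    by_contra hY
    rw [Bool.not_eq_false] at hY
    apply hne
    let x : {x // x ∈ K} → F := fun σ => ψ σ.1
    have hx : ∀ τ, Lfun F K τ x = cob ψ τ := by
      intro τ
      simp only [Lfun, LinearMap.coe_mk, AddHom.coe_mk]
      congr 1
      funext σ
      by_cases h : σ ∈ K
      · simp [h, x]
      · simp [h, h0]
    let N : Submodule F (({x // x ∈ K} → F) →ₗ[F] F) := LinearMap.ker (LinearMap.applyₗ x)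
    have hN : Submodule.span F (Set.range L) ≤ N := by
      rw [← hsp, Submodule.span_le]
      rintro _ ⟨i, rfl⟩
      simp only [N, SetLike.mem_coe, LinearMap.mem_ker, LinearMap.applyₗ_apply_apply]
      simp only [Function.comp, L]
      rw [hx]
      exact hA _ (by simp)
    have := hN (Submodule.subset_span ⟨⟨τ, hY⟩, rfl⟩)
    simp only [N, LinearMap.mem_ker, LinearMap.applyₗ_apply_apply, L] at this
    rwa [hx] at this

lemma bad_struct {n d : ℕ} (F : Type) [Field F] (Y : FaceIdx n d → Bool) (hb : Bad n d F Y) :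
    ∃ (K : Finset (Finset (Fin n))) (A : Finset (FaceIdx n d)), K.Nonempty ∧
      (∀ σ ∈ K, σ.card = d) ∧ A ⊆ hitF d K ∧ A.card ≤ K.card ∧ (∀ τ ∈ A, Y τ = true) ∧
      (∀ τ ∈ WSF F K A, Y τ = false) ∧ n * K.card ≤ (d + 1) * (WSF F K A).card ∧
      (S1F d K).card ≤ (WSF F K A).card := by
  classical
  obtain ⟨φ, hφ, τ0, hτ0⟩ := hb
  let S : Finset (FaceIdx n d) := Finset.univ.filter fun τ => cob φ τ.1 ≠ 0
  have hn : 0 < n := by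
    rcases Nat.eq_zero_or_pos n with rfl | h
    · have := τ0.2
      rw [Finset.eq_empty_of_isEmpty τ0.1] at this
      simp at this
    · exact h
  have hsum : ∑ v : Fin n, (S.filter (fun τ => v ∈ τ.1)).card = (d + 1) * S.card := by
    simp_rw [Finset.card_filter]
    rw [Finset.sum_comm]
    have : ∀ τ ∈ S, (∑ v : Fin n, if v ∈ τ.1 then 1 else 0) = d + 1 := by
      intro τ _
      rw [← Finset.card_filter, Finset.filter_mem_eq_inter, Finset.univ_inter, τ.2]
    rw [Finset.sum_congr rfl this, Finset.sum_const, smul_eq_mul, mul_comm]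
  obtain ⟨v, hv⟩ : ∃ v : Fin n, n * (S.filter (fun τ => v ∈ τ.1)).card ≤ (d + 1) * S.card := by
    by_contra hcon
    push Not at hcon
    have h1 : ∑ v : Fin n, (d + 1) * S.card < ∑ v : Fin n, n * (S.filter (fun τ => v ∈ τ.1)).card :=
      Finset.sum_lt_sum_of_nonempty ⟨⟨0, hn⟩, by simp⟩ (fun v _ => hcon v)
    rw [Finset.sum_const, ← Finset.mul_sum, hsum] at h1
    simp at h1
  let ψ : Finset (Fin n) → F := fun σ => if σ.card = d then nrm v (cob φ) σ else 0
  have hψ : ∀ τ : FaceIdx n d, cob ψ τ.1 = cob φ τ.1 := by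
    intro τ
    rw [← cob_nrm v (cob φ) (cob_cob φ) τ.1]
    exact cob_congr (d := d) _ _ (fun σ hσ => by simp [ψ, hσ]) _ τ.2
  let K : Finset (Finset (Fin n)) := Finset.univ.filter fun σ => ψ σ ≠ 0
  have hK : ∀ σ, σ ∈ K ↔ ψ σ ≠ 0 := by intro σ; simp [K]
  have hKd : ∀ σ ∈ K, σ.card = d := by
    intro σ hσ
    rw [hK] at hσ
    by_contra h
    simp [ψ, h] at hσ
  have hKv : ∀ σ ∈ K, v ∉ σ ∧ cob φ (insert v σ) ≠ 0 := by
    intro σ hσ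
    have hd := hKd σ hσ
    rw [hK] at hσ
    simp only [ψ, hd, if_true, nrm] at hσ
    by_cases h : v ∈ σ
    · simp [h] at hσ
    · refine ⟨h, fun h0 => ?_⟩
      simp [h0] at hσ
  have hKS : K.card ≤ (S.filter (fun τ => v ∈ τ.1)).card := by
    refine Finset.card_le_card_of_injOn (fun σ => if h : (insert v σ).card = d + 1 then ⟨insert v σ, h⟩ else τ0) ?_ ?_
    · intro σ hσ
      have h1 := hKv σ hσ
      have hc : (insert v σ).card = d + 1 := by rw [Finset.card_insert_of_notMem h1.1, hKd σ hσ]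
      simp only [hc, dite_true, SetLike.mem_coe, Finset.mem_filter, S, Finset.mem_univ, true_and]
      simp [h1.2]
    · intro σ hσ σ' hσ' h
      have h1 := hKv σ hσ
      have h1' := hKv σ' hσ'
      have hc : (insert v σ).card = d + 1 := by rw [Finset.card_insert_of_notMem h1.1, hKd σ hσ]
      have hc' : (insert v σ').card = d + 1 := by rw [Finset.card_insert_of_notMem h1'.1, hKd σ' hσ']
      simp only [hc, hc', dite_true, Subtype.mk.injEq] at h
      rw [← Finset.erase_insert h1.1, h, Finset.erase_insert h1'.1]
  obtain ⟨A, hA1, hA2, hA3, hA4⟩ := exists_basis_faces F K hKd Y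
  have hSW : S ⊆ WSF F K A := by
    intro τ hτ
    simp only [S, WSF, Finset.mem_filter, Finset.mem_univ, true_and] at hτ ⊢
    refine ⟨ψ, fun σ hσ => by_contra fun h => hσ ((hK σ).mpr h), ?_, by rwa [hψ]⟩
    intro τ' hτ'
    rw [hψ]; exact hφ τ' (hA3 τ' hτ')
  have hS1 : S1F d K ⊆ S := by
    intro τ hτ
    simp only [S, S1F, Finset.mem_filter, Finset.mem_univ, true_and] at hτ ⊢
    obtain ⟨σ, ⟨hσK, hστ⟩, huniq⟩ := hτ
    rw [← hψ]
    obtain ⟨w, hw⟩ : ∃ w, w ∈ τ.1 ∧ σ = τ.1.erase w := by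
      have hc : (τ.1 \ σ).card = 1 := by
        rw [Finset.card_sdiff_of_subset hστ, τ.2, hKd σ hσK]; simp
      obtain ⟨w, hw⟩ := Finset.card_eq_one.mp hc
      have hwm : w ∈ τ.1 \ σ := by rw [hw]; simp
      refine ⟨w, (Finset.mem_sdiff.mp hwm).1, ?_⟩
      rw [← Finset.sdiff_singleton_eq_erase, ← hw, Finset.sdiff_sdiff_eq_self hστ]
    obtain ⟨hw1, rfl⟩ := hw
    unfold cob
    rw [Finset.sum_eq_single w]
    · intro h
      exact (hK _).mp hσK (sg_smul_eq_zero _ _ _ h)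
    · intro w' hw' hne
      by_contra h
      have hK' : τ.1.erase w' ∈ K := by
        rw [hK]; intro h0; rw [h0] at h; simp at h
      have := huniq _ ⟨hK', Finset.erase_subset _ _⟩
      have h3 : w' ∈ τ.1.erase w := by simp [hne, hw']
      rw [← this] at h3; simp at h3
    · intro h; exact absurd hw1 h
  refine ⟨K, A, ?_, hKd, hA1, hA2, hA3, hA4, ?_, ?_⟩
  · by_contra hne
    rw [Finset.not_nonempty_iff_eq_empty] at hne
    apply hτ0
    rw [← hψ]
    unfold cob
    apply Finset.sum_eq_zero
    intro w _
    have : ψ (τ0.1.erase w) = 0 := by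
      by_contra h
      have := (hK _).mpr h
      rw [hne] at this; simp at this
    rw [this, smul_zero]
  · calc n * K.card ≤ n * _ := Nat.mul_le_mul_left _ hKS
      _ ≤ (d + 1) * S.card := hv
      _ ≤ _ := Nat.mul_le_mul_left _ (Finset.card_le_card hSW)
  · exact Finset.card_le_card (hS1.trans hSW)

/-- neighbourhood of a set: exchange one element -/
def nb {n : ℕ} (t : Finset (Fin n)) : Finset (Finset (Fin n)) :=
  (t ×ˢ (Finset.univ : Finset (Fin n))).image fun q => insert q.2 (t.erase q.1)

/-- neighbourhood of a family -/
def nbT {n : ℕ} (T : Finset (Finset (Fin n))) : Finset (Finset (Fin n)) := T.biUnion nb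

lemma mem_nb {n : ℕ} {s t : Finset (Fin n)} :
    s ∈ nb t ↔ ∃ x ∈ t, ∃ w, insert w (t.erase x) = s := by
  constructor
  · intro h
    obtain ⟨q, hq, rfl⟩ := Finset.mem_image.mp h
    exact ⟨q.1, (Finset.mem_product.mp hq).1, q.2, rfl⟩
  · rintro ⟨x, hx, w, rfl⟩
    exact Finset.mem_image.mpr ⟨(x, w), by simp [hx], rfl⟩

lemma nb_card {n : ℕ} (t : Finset (Fin n)) : (nb t).card ≤ t.card * n := by
  refine Finset.card_image_le.trans ?_
  simp

lemma nbT_card {n d : ℕ} (T : Finset (Finset (Fin n))) (hT : ∀ t ∈ T, t.card = d) :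
    (nbT T).card ≤ T.card * (d * n) := by
  refine Finset.card_biUnion_le_card_mul _ _ _ fun t ht => ?_
  rw [← hT t ht]; exact nb_card t

lemma nb_symm {n : ℕ} {s t : Finset (Fin n)} (hst : s.card = t.card) (h : s ∈ nb t) : t ∈ nb s := by
  obtain ⟨x, hx, w, rfl⟩ := mem_nb.mp h
  have hw : w ∉ t.erase x := by
    intro hw
    rw [Finset.insert_eq_of_mem hw, Finset.card_erase_of_mem hx] at hst
    have := Finset.card_pos.mpr ⟨x, hx⟩
    omega
  refine mem_nb.mpr ⟨w, by simp, x, ?_⟩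
  rw [Finset.erase_insert hw, Finset.insert_erase hx]

lemma local_count {n d : ℕ} (K : Finset (Finset (Fin n))) (hK : ∀ σ ∈ K, σ.card = d)
    (σ : Finset (Fin n)) (hσ : σ ∈ K) :
    n - d ≤ (K.filter (fun s => s ∈ nb σ)).card + ((S1F d K).filter (fun τ => σ ⊆ τ.1)).card := by
  classical
  let G : Finset (Fin n) := Finset.univ.filter fun w => w ∉ σ
  have hG : G.card = n - d := by
    have : G = σᶜ := by ext; simp [G]
    rw [this, Finset.card_compl, hK σ hσ]; simp
  rw [← hG, ← Finset.card_filter_add_card_filter_not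
    (p := fun w => ∃ s ∈ K, s ∈ nb σ ∧ w ∈ s ∧ s.erase w ⊆ σ) (s := G)]
  apply Nat.add_le_add
  · refine Finset.card_le_card_of_forall_subsingleton (fun w s => w ∈ s ∧ s.erase w ⊆ σ) ?_ ?_
    · intro w hw
      obtain ⟨_, s, hs, hs2, hs3⟩ := Finset.mem_filter.mp hw
      exact ⟨s, by simp [hs, hs2], hs3⟩
    · intro s _ w hw w' hw'
      by_contra hne
      have h1 : w' ∉ σ := by
        have := hw'.1; simp [G] at this; exact this.1
      exact h1 (hw.2.2 (by simp [hw'.2.1, Ne.symm hne]))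
  · refine Finset.card_le_card_of_forall_subsingleton (fun w τ => insert w σ = τ.1) ?_ ?_
    · intro w hw
      obtain ⟨hw1, hw2⟩ := Finset.mem_filter.mp hw
      have hwσ : w ∉ σ := by simpa [G] using hw1
      refine ⟨⟨insert w σ, by rw [Finset.card_insert_of_notMem hwσ, hK σ hσ]⟩, ?_, rfl⟩
      simp only [S1F, Finset.mem_filter, Finset.mem_univ, true_and, Finset.subset_insert, and_true]
      refine ⟨σ, ⟨hσ, Finset.subset_insert _ _⟩, ?_⟩
      rintro s ⟨hs, hs2⟩
      by_contra hne
      apply hw2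
      have hws : w ∈ s := by
        by_contra hws
        apply hne
        apply Finset.eq_of_subset_of_card_le
        · intro y hy
          rcases Finset.mem_insert.mp (hs2 hy) with rfl | h
          · exact absurd hy hws
          · exact h
        · rw [hK σ hσ, hK s hs]
      have her : s.erase w ⊆ σ := by
        intro y hy
        rw [Finset.mem_erase] at hy
        rcases Finset.mem_insert.mp (hs2 hy.2) with h | h
        · exact absurd h hy.1
        · exact h
      refine ⟨s, hs, ?_, hws, her⟩
      have hcard : (σ \ s.erase w).card = 1 := by
        rw [Finset.card_sdiff_of_subset her, Finset.card_erase_of_mem hws, hK s hs, hK σ hσ]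
        have : 0 < d := by rw [← hK s hs]; exact Finset.card_pos.mpr ⟨w, hws⟩
        omega
      obtain ⟨x, hx⟩ := Finset.card_eq_one.mp hcard
      have hxm : x ∈ σ \ s.erase w := by rw [hx]; simp
      refine mem_nb.mpr ⟨x, (Finset.mem_sdiff.mp hxm).1, w, ?_⟩
      have : σ.erase x = s.erase w := by
        rw [← Finset.sdiff_singleton_eq_erase, ← hx, Finset.sdiff_sdiff_eq_self her]
      rw [this, Finset.insert_erase hws]
    · intro τ _ w hw w' hw'
      have h1 : w' ∉ σ := by
        have := hw'.1; simp [G] at this; exact this.1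
      have h2 : w' ∈ insert w σ := by rw [hw.2, ← hw'.2]; simp
      rcases Finset.mem_insert.mp h2 with h | h
      · exact h.symm
      · exact absurd h h1

lemma encode {n d : ℕ} (hn : 1 ≤ n) (K : Finset (Finset (Fin n))) (hK : ∀ σ ∈ K, σ.card = d)
    (hne : K.Nonempty) :
    ∃ T ⊆ K, n * T.card ≤ (d + 1) * K.card ∧ (T.Nonempty ∨ (K \ nbT T).Nonempty) ∧
      ∀ s : ℕ, (S1F d K).card ≤ s → n * K.card ≤ (d + 1) * s →
        (K \ nbT T).card * (n - d) ≤ 2 * s := by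
  classical
  obtain ⟨T, hT, hmax⟩ := Finset.exists_max_image
    (K.powerset.filter fun T => n * T.card ≤ (d + 1) * (K ∩ nbT T).card) Finset.card
    ⟨∅, by simp⟩
  obtain ⟨hTK, hTn⟩ := Finset.mem_filter.mp hT
  rw [Finset.mem_powerset] at hTK
  refine ⟨T, hTK, hTn.trans (Nat.mul_le_mul_left _ (Finset.card_le_card Finset.inter_subset_left)),
    ?_, ?_⟩
  · rcases T.eq_empty_or_nonempty with h | h
    · right; rw [h]; simpa [nbT] using hne
    · exact Or.inl h
  set U := K \ nbT T with hU
  have key : ∀ σ ∈ K, (d + 1) * (U.filter (fun s => s ∈ nb σ)).card ≤ n := by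
    intro σ hσ
    by_contra hcon
    push Not at hcon
    have hσT : σ ∉ T := by
      intro hσT
      have : U.filter (fun s => s ∈ nb σ) = ∅ := by
        apply Finset.filter_eq_empty_iff.mpr
        intro s hs hs2
        rw [hU, Finset.mem_sdiff] at hs
        exact hs.2 (Finset.mem_biUnion.mpr ⟨σ, hσT, hs2⟩)
      rw [this] at hcon; simp at hcon
    have hsub : (K ∩ nbT T) ∪ U.filter (fun s => s ∈ nb σ) ⊆ K ∩ nbT (insert σ T) := by
      intro s hs
      rw [Finset.mem_union, Finset.mem_inter, Finset.mem_filter, hU, Finset.mem_sdiff] at hs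
      rw [Finset.mem_inter, nbT, Finset.biUnion_insert, Finset.mem_union]
      rcases hs with h | h
      · exact ⟨h.1, Or.inr h.2⟩
      · exact ⟨h.1.1, Or.inl h.2⟩
    have hdis : Disjoint (K ∩ nbT T) (U.filter (fun s => s ∈ nb σ)) := by
      rw [Finset.disjoint_left]
      intro s hs hs2
      rw [Finset.mem_filter, hU, Finset.mem_sdiff] at hs2
      exact hs2.1.2 (Finset.mem_inter.mp hs).2
    have hc := Finset.card_le_card hsub
    rw [Finset.card_union_of_disjoint hdis] at hc
    have hins : (insert σ T).card = T.card + 1 := Finset.card_insert_of_notMem hσT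
    have := hmax (insert σ T) (Finset.mem_filter.mpr ⟨Finset.mem_powerset.mpr
      (Finset.insert_subset hσ hTK), by
        rw [hins]
        calc n * (T.card + 1) = n * T.card + n := by ring
          _ ≤ (d + 1) * (K ∩ nbT T).card + (d + 1) * (U.filter (fun s => s ∈ nb σ)).card :=
            Nat.add_le_add hTn hcon.le
          _ = (d + 1) * ((K ∩ nbT T).card + (U.filter (fun s => s ∈ nb σ)).card) := by ring
          _ ≤ _ := Nat.mul_le_mul_left _ hc⟩)
    omega
  intro s hs1 hs2
  have hUK : U ⊆ K := Finset.sdiff_subset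
  have h1 : U.card * (n - d) ≤ ∑ σ ∈ U, ((K.filter (fun s => s ∈ nb σ)).card +
      ((S1F d K).filter (fun τ => σ ⊆ τ.1)).card) := by
    rw [← smul_eq_mul]
    exact Finset.card_nsmul_le_sum _ _ _ fun σ hσ => local_count K hK σ (hUK hσ)
  rw [Finset.sum_add_distrib] at h1
  have h2 : ∑ σ ∈ U, (K.filter (fun s => s ∈ nb σ)).card ≤
      ∑ σ ∈ K, (U.filter (fun s => s ∈ nb σ)).card := by
    have e := Finset.sum_card_bipartiteAbove_eq_sum_card_bipartiteBelow (s := U) (t := K)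
      (fun σ s => s ∈ nb σ)
    unfold Finset.bipartiteAbove Finset.bipartiteBelow at e
    rw [e]
    refine Finset.sum_le_sum fun σ hσ => Finset.card_le_card ?_
    intro s hs
    rw [Finset.mem_filter] at hs ⊢
    exact ⟨hs.1, nb_symm (by rw [hK σ hσ, hK s (hUK hs.1)]) hs.2⟩
  have h3 : ∑ σ ∈ U, ((S1F d K).filter (fun τ => σ ⊆ τ.1)).card ≤ (S1F d K).card := by
    have e := Finset.sum_card_bipartiteAbove_eq_sum_card_bipartiteBelow (s := U) (t := S1F d K)
      (fun σ τ => σ ⊆ τ.1)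
    unfold Finset.bipartiteAbove Finset.bipartiteBelow at e
    rw [e, Finset.card_eq_sum_ones]
    refine Finset.sum_le_sum fun τ hτ => ?_
    rw [Finset.card_le_one]
    intro a ha b hb
    rw [Finset.mem_filter] at ha hb
    have hu : ∃! σ, σ ∈ K ∧ σ ⊆ τ.1 := by simpa [S1F] using hτ
    exact hu.unique ⟨hUK ha.1, ha.2⟩ ⟨hUK hb.1, hb.2⟩
  have h4 : (d + 1) * ∑ σ ∈ K, (U.filter (fun s => s ∈ nb σ)).card ≤ (d + 1) * s := by
    rw [Finset.mul_sum]
    calc _ ≤ ∑ σ ∈ K, n := Finset.sum_le_sum key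
      _ = n * K.card := by simp [mul_comm]
      _ ≤ _ := hs2
  have h5 := Nat.le_of_mul_le_mul_left h4 (Nat.succ_pos d)
  omega

lemma hitF_card {n d : ℕ} (K : Finset (Finset (Fin n))) (hK : ∀ σ ∈ K, σ.card = d) :
    (hitF d K).card ≤ K.card * n := by
  classical
  have h : (hitF d K).card ≤ (K ×ˢ (Finset.univ : Finset (Fin n))).card := by
    refine Finset.card_le_card_of_forall_subsingleton (fun τ q => τ.1 = insert q.2 q.1) ?_ ?_
    · intro τ hτ
      obtain ⟨σ, hσ, hs⟩ := (Finset.mem_filter.mp hτ).2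
      have hc : (τ.1 \ σ).card = 1 := by
        rw [Finset.card_sdiff_of_subset hs, τ.2, hK σ hσ]; omega
      obtain ⟨x, hx⟩ := Finset.card_eq_one.mp hc
      refine ⟨(σ, x), by simp [hσ], ?_⟩
      show τ.1 = insert x σ
      rw [← Finset.sdiff_union_of_subset hs, hx]; rfl
    · intro q _ a ha b hb
      exact Subtype.ext (ha.2.trans hb.2.symm)
  simpa using h

lemma numeric_core (n d k s t u N : ℕ) (p : ℝ) (hd : 1 ≤ d) (hn : 4 * (d + 1) ^ 2 ≤ n)
    (hL : 4 * ((d : ℝ) + 1) ^ 2 + ((d : ℝ) + 1) ^ 3 ≤ Real.log n)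
    (hp : 40 * d * Real.log n / n ≤ p)
    (hk : n * k ≤ (d + 1) * s) (ht : n * t ≤ (d + 1) * k) (htu : 1 ≤ t + u)
    (hu : u * (n - d) ≤ 2 * s) (hN : N ≤ t * (d * n)) :
    Real.exp (-(p * s)) ≤ ((Real.exp 1 * (n * p)) ^ k)⁻¹ * (((n : ℝ) ^ (3 * d))⁻¹ *
      ((((n : ℝ) ^ d)⁻¹) ^ u * ((((n : ℝ) ^ d)⁻¹) ^ t * ((1 : ℝ) / 2) ^ N))) := by
  have hn0 : 0 < n := lt_of_lt_of_le (by positivity) hn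
  have hnR : (0 : ℝ) < n := by exact_mod_cast hn0
  have hdR : (1 : ℝ) ≤ d := by exact_mod_cast hd
  set L := Real.log n with hLdef
  have hL0 : 0 < L := lt_of_lt_of_le (by positivity) hL
  have hp0 : 0 < p := lt_of_lt_of_le (by positivity) hp
  have hexpL : (n : ℝ) = Real.exp L := (Real.exp_log hnR).symm
  have hnp : 0 < n * p := by positivity
  have hnpe : n * p = Real.exp (Real.log (n * p)) := (Real.exp_log hnp).symm
  have hrhs : ((Real.exp 1 * (n * p)) ^ k)⁻¹ * (((n : ℝ) ^ (3 * d))⁻¹ *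
      ((((n : ℝ) ^ d)⁻¹) ^ u * ((((n : ℝ) ^ d)⁻¹) ^ t * ((1 : ℝ) / 2) ^ N))) =
      Real.exp (-(k * (1 + Real.log (n * p)) + 3 * d * L + d * L * u + d * L * t
        + N * Real.log 2)) := by
    have e1 : (Real.exp 1 * (n * p)) ^ k = Real.exp (k * (1 + Real.log (n * p))) := by
      rw [Real.exp_nat_mul, Real.exp_add, ← hnpe]
    have e2 : ∀ m : ℕ, (n : ℝ) ^ m = Real.exp (m * L) := by
      intro m; rw [Real.exp_nat_mul, ← hexpL]
    have e3 : ((1 : ℝ) / 2) ^ N = Real.exp (-(N * Real.log 2)) := by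
      rw [Real.exp_neg, Real.exp_nat_mul, Real.exp_log (by norm_num)]; simp
    rw [e1, e2, e2, e3, ← Real.exp_neg, ← Real.exp_neg, ← Real.exp_neg, ← Real.exp_nat_mul,
      ← Real.exp_nat_mul, ← Real.exp_add, ← Real.exp_add, ← Real.exp_add, ← Real.exp_add]
    congr 1
    push_cast
    ring
  rw [hrhs]
  apply Real.exp_le_exp.mpr
  apply neg_le_neg
  set r : ℝ := s / n with hr
  have hs : (s : ℝ) = n * r := by rw [hr]; field_simp
  have hr0 : 0 ≤ r := by positivity
  have hnd : 2 * d ≤ n := by nlinarith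
  have hk' : (k : ℝ) ≤ (d + 1) * r := by
    have : (n : ℝ) * k ≤ (d + 1) * s := by exact_mod_cast hk
    rw [hs] at this
    have h2 : (n : ℝ) * k ≤ n * ((d + 1) * r) := by linarith
    exact le_of_mul_le_mul_left h2 hnR
  have hu' : (u : ℝ) ≤ 4 * r := by
    have h1 : u * n ≤ 4 * s := by
      have : u * n ≤ u * (2 * (n - d)) := Nat.mul_le_mul_left _ (by omega)
      nlinarith
    have h2 : (u : ℝ) * n ≤ 4 * s := by exact_mod_cast h1
    rw [hs] at h2
    have h3 : (n : ℝ) * u ≤ n * (4 * r) := by linarith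
    exact le_of_mul_le_mul_left h3 hnR
  have hnt : (n : ℝ) * t ≤ (d + 1) * k := by exact_mod_cast ht
  have hnt2 : (n : ℝ) * t ≤ (d + 1) ^ 2 * r := by
    calc (n : ℝ) * t ≤ (d + 1) * k := hnt
      _ ≤ (d + 1) * ((d + 1) * r) := by gcongr
      _ = _ := by ring
  have ht' : 4 * (t : ℝ) ≤ r := by
    have h1 : 4 * ((d : ℝ) + 1) ^ 2 * t ≤ n * t := by
      gcongr; exact_mod_cast hn
    have h2 : ((d : ℝ) + 1) ^ 2 * (4 * t) ≤ (d + 1) ^ 2 * r := by linarith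
    exact le_of_mul_le_mul_left h2 (by positivity)
  have hN' : (N : ℝ) ≤ d * (d + 1) ^ 2 * r := by
    have h1 : (N : ℝ) ≤ t * (d * n) := by exact_mod_cast hN
    calc (N : ℝ) ≤ d * (n * t) := by linarith
      _ ≤ d * ((d + 1) ^ 2 * r) := by gcongr
      _ = _ := by ring
  have hlog : 1 + Real.log (n * p) ≤ n * p / (4 * (d + 1)) + 4 * (d + 1) := by
    have h1 := Real.log_le_sub_one_of_pos (x := n * p / (4 * (d + 1))) (by positivity)
    rw [Real.log_div (by positivity) (by positivity)] at h1
    have h2 := Real.log_le_sub_one_of_pos (x := 4 * ((d : ℝ) + 1)) (by positivity)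
    linarith
  have hps : 40 * d * L * r ≤ p * s := by
    rw [div_le_iff₀ hnR] at hp
    rw [hs]
    have := mul_le_mul_of_nonneg_right hp hr0
    linarith
  have a1 : k * (1 + Real.log (n * p)) ≤ p * s / 4 + 4 * (d + 1) ^ 2 * r := by
    calc k * (1 + Real.log (n * p)) ≤ k * (n * p / (4 * (d + 1)) + 4 * (d + 1)) := by gcongr
      _ ≤ ((d + 1) * r) * (n * p / (4 * (d + 1)) + 4 * (d + 1)) := by gcongr
      _ = _ := by rw [hs]; field_simp
  have htu' : (1 : ℝ) ≤ t + u := by exact_mod_cast htu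
  have hdL : 0 < d * L := by positivity
  have a2 : 3 * d * L ≤ 3 * (d * L) * (t + u) := by
    have := mul_le_mul_of_nonneg_left htu' (by positivity : 0 ≤ 3 * (d * L))
    linarith
  have a3 : (d * L) * u ≤ (d * L) * (4 * r) := by gcongr
  have a4 : (d * L) * (4 * t) ≤ (d * L) * r := by gcongr
  have a5 : N * Real.log 2 ≤ d * (d + 1) ^ 2 * r := by
    have : Real.log 2 ≤ 1 := by
      have := Real.log_le_sub_one_of_pos (x := 2) (by norm_num); linarith
    calc N * Real.log 2 ≤ N * 1 := by gcongr
      _ ≤ _ := by linarith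
  have a6 : (4 * ((d : ℝ) + 1) ^ 2 + ((d : ℝ) + 1) ^ 3) * r ≤ (d * L) * r := by
    apply mul_le_mul_of_nonneg_right _ hr0
    exact hL.trans (le_mul_of_one_le_left hL0.le hdR)
  have a7 : (d : ℝ) * (d + 1) ^ 2 * r ≤ (d + 1) ^ 3 * r := by
    apply mul_le_mul_of_nonneg_right _ hr0
    have : ((d : ℝ) + 1) ^ 3 = d * (d + 1) ^ 2 + (d + 1) ^ 2 := by ring
    have := sq_nonneg ((d : ℝ) + 1)
    linarith
  have a8 : 0 ≤ d * L * r := by positivity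
  linarith

lemma bern_true (p : ℝ) (h0 : 0 ≤ p) (h1 : p ≤ 1) : bernoulliBool p {true} = ENNReal.ofReal p := by
  simp [bernoulliBool, h0, h1]

lemma bern_false (p : ℝ) (h0 : 0 ≤ p) (h1 : p ≤ 1) :
    bernoulliBool p {false} = ENNReal.ofReal (1 - p) := by
  simp [bernoulliBool, h0, h1]

instance bern_prob (p : ℝ) : IsProbabilityMeasure (bernoulliBool p) := by
  constructor
  simp only [bernoulliBool, Measure.add_apply, Measure.smul_apply, smul_eq_mul,
    measure_univ, mul_one]
  rw [← ENNReal.ofReal_add (by simp) (by simp)]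
  simp

instance Y_prob (n d : ℕ) (p : ℝ) : IsProbabilityMeasure (YMeasure n d p) := by
  unfold YMeasure; infer_instance

lemma rect_prob {n d : ℕ} (p : ℝ) (h0 : 0 ≤ p) (h1 : p ≤ 1) (A W : Finset (FaceIdx n d)) :
    YMeasure n d p {Y | (∀ τ ∈ A, Y τ = true) ∧ (∀ τ ∈ W, Y τ = false)} ≤
      ENNReal.ofReal (p ^ A.card * Real.exp (-(p * W.card))) := by
  classical
  by_cases hdis : Disjoint A W
  · have hset : {Y : FaceIdx n d → Bool | (∀ τ ∈ A, Y τ = true) ∧ (∀ τ ∈ W, Y τ = false)} =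
        Set.pi Set.univ (fun τ => if τ ∈ A then {true} else if τ ∈ W then {false} else Set.univ) := by
      ext Y
      simp only [Set.mem_ofPred_eq, Set.mem_pi, Set.mem_univ, true_imp_iff]
      constructor
      · rintro ⟨ha, hw⟩ τ
        split_ifs with h h'
        · exact ha τ h
        · exact hw τ h'
        · trivial
      · intro h
        constructor
        · intro τ hτ
          simpa [hτ] using h τ
        · intro τ hτ
          have : τ ∉ A := fun hA => Finset.disjoint_left.mp hdis hA hτ
          simpa [hτ, this] using h τ
    rw [hset, YMeasure, Measure.pi_pi]
    have hv : ∀ τ : FaceIdx n d, bernoulliBool p (if τ ∈ A then {true} else if τ ∈ W then {false}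
        else Set.univ) = (if τ ∈ A then ENNReal.ofReal p else 1) *
          (if τ ∈ W then ENNReal.ofReal (1 - p) else 1) := by
      intro τ
      by_cases hA : τ ∈ A
      · have : τ ∉ W := fun hW => Finset.disjoint_left.mp hdis hA hW
        simp [hA, this, bern_true p h0 h1]
      · by_cases hW : τ ∈ W
        · simp [hA, hW, bern_false p h0 h1]
        · rw [if_neg hA, if_neg hW, if_neg hA, if_neg hW, measure_univ, one_mul]
    rw [Finset.prod_congr rfl fun τ _ => hv τ, Finset.prod_mul_distrib]
    simp only [Finset.prod_ite_mem, Finset.univ_inter, Finset.prod_const]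
    rw [← ENNReal.ofReal_pow h0, ← ENNReal.ofReal_pow (by linarith), ← ENNReal.ofReal_mul (by positivity)]
    apply ENNReal.ofReal_le_ofReal
    gcongr
    have : 1 - p ≤ Real.exp (-p) := by have := Real.add_one_le_exp (-p); linarith
    calc (1 - p) ^ W.card ≤ (Real.exp (-p)) ^ W.card := by
          apply pow_le_pow_left₀ (by linarith) this
      _ = _ := by rw [← Real.exp_nat_mul]; congr 1; ring
  · have : {Y : FaceIdx n d → Bool | (∀ τ ∈ A, Y τ = true) ∧ (∀ τ ∈ W, Y τ = false)} = ∅ := by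
      ext Y
      simp only [Set.mem_ofPred_eq, Set.mem_empty_iff_false, iff_false]
      rintro ⟨ha, hw⟩
      apply hdis
      rw [Finset.disjoint_left]
      intro τ h h'
      have := ha τ h
      rw [hw τ h'] at this
      exact absurd this (by simp)
    rw [this]; simp

lemma sum_powerset_le {α : Type*} [DecidableEq α] (D : Finset α) (x c : ℝ) (hx : 0 ≤ x)
    (h : D.card * x ≤ c) : ∑ t ∈ D.powerset, x ^ t.card ≤ Real.exp c := by
  have e := Finset.sum_pow_mul_eq_add_pow x 1 D
  simp only [one_pow, mul_one] at e
  rw [e]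
  calc (x + 1) ^ D.card ≤ (Real.exp x) ^ D.card := by
        apply pow_le_pow_left₀ (by linarith) (Real.add_one_le_exp x)
    _ = Real.exp (D.card * x) := (Real.exp_nat_mul _ _).symm
    _ ≤ _ := Real.exp_le_exp.mpr h

lemma sum_A_le {α : Type*} [DecidableEq α] (H : Finset α) (n k : ℕ) (p : ℝ) (hn : 0 < n)
    (hnp : 1 ≤ n * p) (hH : H.card ≤ k * n) :
    ∑ A ∈ H.powerset.filter (fun A => A.card ≤ k), p ^ A.card ≤ (Real.exp 1 * (n * p)) ^ k := by
  have hnR : (0 : ℝ) < n := by exact_mod_cast hn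
  have hp : 0 < p := by
    by_contra h
    push Not at h
    nlinarith
  have h1 : ∀ A ∈ H.powerset.filter (fun A => A.card ≤ k), p ^ A.card ≤
      (n * p) ^ k * ((1 : ℝ) / n) ^ A.card := by
    intro A hA
    have hc := (Finset.mem_filter.mp hA).2
    calc p ^ A.card = (n * p) ^ A.card * ((1 : ℝ) / n) ^ A.card := by
          rw [← mul_pow]; congr 1; field_simp
      _ ≤ _ := by gcongr
  calc _ ≤ ∑ A ∈ H.powerset.filter (fun A => A.card ≤ k), (n * p) ^ k * ((1 : ℝ) / n) ^ A.card :=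
        Finset.sum_le_sum h1
    _ ≤ ∑ A ∈ H.powerset, (n * p) ^ k * ((1 : ℝ) / n) ^ A.card := by
        apply Finset.sum_le_sum_of_subset_of_nonneg (Finset.filter_subset _ _)
        intros; positivity
    _ = (n * p) ^ k * ∑ A ∈ H.powerset, ((1 : ℝ) / n) ^ A.card := by rw [Finset.mul_sum]
    _ ≤ (n * p) ^ k * Real.exp (k * 1) := by
        gcongr
        apply sum_powerset_le _ _ _ (by positivity)
        have : (H.card : ℝ) ≤ k * n := by exact_mod_cast hH
        rw [mul_one_div, div_le_iff₀ hnR]; linarith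
    _ = _ := by rw [Real.exp_nat_mul, mul_pow]; ring

lemma sum_K_le {n d : ℕ} (hn : 0 < n) (KK : Finset (Finset (Finset (Fin n))))
    (hKK : ∀ K ∈ KK, ∀ σ ∈ K, σ.card = d) (T : Finset (Finset (Fin n)) → Finset (Finset (Fin n)))
    (hT : ∀ K ∈ KK, T K ⊆ K) :
    ∑ K ∈ KK, ((((n : ℝ) ^ d)⁻¹) ^ (K \ nbT (T K)).card * ((((n : ℝ) ^ d)⁻¹) ^ (T K).card *
      ((1 : ℝ) / 2) ^ (nbT (T K)).card)) ≤ Real.exp 2 := by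
  classical
  set x : ℝ := ((n : ℝ) ^ d)⁻¹ with hx
  have hnR : (0 : ℝ) < n := by exact_mod_cast hn
  have hx0 : 0 ≤ x := by positivity
  let D : Finset (Finset (Fin n)) := Finset.powersetCard d Finset.univ
  have hD : (D.card : ℝ) * x ≤ 1 := by
    have : D.card ≤ n ^ d := by
      simp only [D, Finset.card_powersetCard, Finset.card_univ, Fintype.card_fin]
      exact Nat.choose_le_pow n d
    have : (D.card : ℝ) ≤ (n : ℝ) ^ d := by exact_mod_cast this
    rw [hx, ← div_eq_mul_inv, div_le_one (by positivity)]; exact this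
  have hsD := sum_powerset_le D x 1 hx0 hD
  have hKD : ∀ K ∈ KK, K ⊆ D := by
    intro K hK σ hσ
    simp [D, Finset.mem_powersetCard, hKK K hK σ hσ]
  let SS : Finset (Σ _ : Finset (Finset (Fin n)) × Finset (Finset (Fin n)), Finset (Finset (Fin n))) :=
    (D.powerset ×ˢ D.powerset).sigma fun q => (nbT q.1).powerset
  let e : Finset (Finset (Fin n)) →
      (Σ _ : Finset (Finset (Fin n)) × Finset (Finset (Fin n)), Finset (Finset (Fin n))) :=
    fun K => ⟨(T K, K \ nbT (T K)), K ∩ nbT (T K)⟩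
  let g : (Σ _ : Finset (Finset (Fin n)) × Finset (Finset (Fin n)), Finset (Finset (Fin n))) → ℝ :=
    fun q => x ^ q.1.2.card * (x ^ q.1.1.card * ((1 : ℝ) / 2) ^ (nbT q.1.1).card)
  have hinj : Set.InjOn e KK := by
    intro K _ K' _ h
    simp only [e, Sigma.mk.injEq, Prod.mk.injEq] at h
    have h1 := h.1.2
    have h2 := eq_of_heq h.2
    rw [← Finset.sdiff_union_inter K (nbT (T K)), h1, h2, Finset.sdiff_union_inter]
  calc _ = ∑ K ∈ KK, g (e K) := rfl
    _ = ∑ q ∈ KK.image e, g q := (Finset.sum_image hinj).symm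
    _ ≤ ∑ q ∈ SS, g q := by
        apply Finset.sum_le_sum_of_subset_of_nonneg
        · intro q hq
          obtain ⟨K, hK, rfl⟩ := Finset.mem_image.mp hq
          simp only [SS, e, Finset.mem_sigma, Finset.mem_product, Finset.mem_powerset]
          exact ⟨⟨(hT K hK).trans (hKD K hK), Finset.sdiff_subset.trans (hKD K hK)⟩,
            Finset.inter_subset_right⟩
        · intro q _ _
          simp only [g]; positivity
    _ = ∑ q ∈ D.powerset ×ˢ D.powerset, x ^ q.1.card * x ^ q.2.card := by
        simp only [SS]
        rw [Finset.sum_sigma]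
        refine Finset.sum_congr rfl fun q _ => ?_
        simp only [g, Finset.sum_const, Finset.card_powerset, nsmul_eq_mul]
        push_cast
        have : (2 : ℝ) ^ (nbT q.1).card * (1 / 2) ^ (nbT q.1).card = 1 := by
          rw [← mul_pow]; norm_num
        linear_combination (x ^ q.1.card * x ^ q.2.card) * this
    _ = (∑ t ∈ D.powerset, x ^ t.card) * (∑ t ∈ D.powerset, x ^ t.card) := by
        rw [Finset.sum_product, Finset.sum_mul_sum]
    _ ≤ Real.exp 1 * Real.exp 1 := by gcongr
    _ = Real.exp 2 := by rw [← Real.exp_add]; norm_num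

lemma bad_prob (n d : ℕ) (p : ℝ) (hd : 1 ≤ d) (hn : 4 * (d + 1) ^ 2 ≤ n)
    (hL : 4 * ((d : ℝ) + 1) ^ 2 + ((d : ℝ) + 1) ^ 3 ≤ Real.log n)
    (hp : 40 * d * Real.log n / n ≤ p) (hp1 : p ≤ 1) (F : Type) [Field F] :
    YMeasure n d p {Y | Bad n d F Y} ≤ ENNReal.ofReal (Real.exp 2 * ((n : ℝ) ^ (3 * d))⁻¹) := by
  classical
  have hn0 : 0 < n := lt_of_lt_of_le (by positivity) hn
  have hnR : (0 : ℝ) < n := by exact_mod_cast hn0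
  have hdR : (1 : ℝ) ≤ d := by exact_mod_cast hd
  have hL0 : 1 ≤ Real.log n := le_trans (by nlinarith [sq_nonneg ((d:ℝ)+1), pow_pos (by linarith : (0:ℝ) < d + 1) 3]) hL
  have hp0 : 0 ≤ p := le_trans (by positivity) hp
  have hnp : 1 ≤ n * p := by
    rw [div_le_iff₀ hnR] at hp
    nlinarith
  let KK : Finset (Finset (Finset (Fin n))) :=
    Finset.univ.filter fun K => K.Nonempty ∧ ∀ σ ∈ K, σ.card = d
  have hKK : ∀ K ∈ KK, K.Nonempty ∧ ∀ σ ∈ K, σ.card = d := by intro K hK; simpa [KK] using hK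
  have hex : ∀ K : Finset (Finset (Fin n)), ∃ T : Finset (Finset (Fin n)), K ∈ KK →
      T ⊆ K ∧ n * T.card ≤ (d + 1) * K.card ∧ (T.Nonempty ∨ (K \ nbT T).Nonempty) ∧
      ∀ s : ℕ, (S1F d K).card ≤ s → n * K.card ≤ (d + 1) * s →
        (K \ nbT T).card * (n - d) ≤ 2 * s := by
    intro K
    by_cases hK : K ∈ KK
    · obtain ⟨T, h⟩ := encode hn0 K (hKK K hK).2 (hKK K hK).1
      exact ⟨T, fun _ => h⟩
    · exact ⟨∅, fun h => absurd h hK⟩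
  choose T hT using hex
  let g : Finset (Finset (Fin n)) → ℝ := fun K =>
    (((n : ℝ) ^ d)⁻¹) ^ (K \ nbT (T K)).card * ((((n : ℝ) ^ d)⁻¹) ^ (T K).card *
      ((1 : ℝ) / 2) ^ (nbT (T K)).card)
  have hg : ∑ K ∈ KK, g K ≤ Real.exp 2 :=
    sum_K_le hn0 KK (fun K hK => (hKK K hK).2) T (fun K hK => (hT K hK).1)
  let AA : Finset (Finset (Fin n)) → Finset (Finset (FaceIdx n d)) := fun K =>
    (hitF d K).powerset.filter fun A => A.card ≤ K.card
  let E : Finset (Finset (Fin n)) → Finset (FaceIdx n d) → Set (FaceIdx n d → Bool) := fun K A =>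
    {Y | ((∀ τ ∈ A, Y τ = true) ∧ (∀ τ ∈ WSF F K A, Y τ = false)) ∧
      n * K.card ≤ (d + 1) * (WSF F K A).card ∧ (S1F d K).card ≤ (WSF F K A).card}
  have hcov : {Y | Bad n d F Y} ⊆ ⋃ K ∈ KK, ⋃ A ∈ AA K, E K A := by
    intro Y hY
    obtain ⟨K, A, h1, h2, h3, h4, h5, h6, h7, h8⟩ := bad_struct F Y hY
    simp only [Set.mem_iUnion]
    refine ⟨K, by simp only [KK, Finset.mem_filter]; exact ⟨Finset.mem_univ _, h1, h2⟩, A, ?_,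
      ⟨h5, h6⟩, h7, h8⟩
    simp only [AA, Finset.mem_filter, Finset.mem_powerset]
    exact ⟨h3, h4⟩
  set c : ℝ := ((n : ℝ) ^ (3 * d))⁻¹ with hc
  have hE : ∀ K ∈ KK, ∀ A ∈ AA K, YMeasure n d p (E K A) ≤
      ENNReal.ofReal (p ^ A.card * (((Real.exp 1 * (n * p)) ^ K.card)⁻¹ * (c * g K))) := by
    intro K hK A _
    obtain ⟨t1, t2, t3, t4⟩ := hT K hK
    by_cases hcond : n * K.card ≤ (d + 1) * (WSF F K A).card ∧ (S1F d K).card ≤ (WSF F K A).card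
    · refine (measure_mono (fun Y hY => hY.1)).trans ((rect_prob p hp0 hp1 A (WSF F K A)).trans ?_)
      apply ENNReal.ofReal_le_ofReal
      gcongr
      refine numeric_core n d K.card _ (T K).card (K \ nbT (T K)).card (nbT (T K)).card p hd hn hL hp
        hcond.1 t2 ?_ (t4 _ hcond.2 hcond.1) ?_
      · rcases t3 with h | h
        · have := Finset.card_pos.mpr h; omega
        · have := Finset.card_pos.mpr h; omega
      · exact nbT_card _ fun t ht => (hKK K hK).2 t (t1 ht)
    · have : E K A = ∅ := by
        ext Y
        simp only [E, Set.mem_ofPred_eq, Set.mem_empty_iff_false, iff_false]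
        exact fun h => hcond h.2
      rw [this]; simp
  have hgK : ∀ K, 0 ≤ g K := fun K => by simp only [g]; positivity
  have hc0 : 0 ≤ c := by positivity
  calc YMeasure n d p {Y | Bad n d F Y} ≤ YMeasure n d p (⋃ K ∈ KK, ⋃ A ∈ AA K, E K A) :=
        measure_mono hcov
    _ ≤ ∑ K ∈ KK, ∑ A ∈ AA K, YMeasure n d p (E K A) :=
        (measure_biUnion_finset_le _ _).trans
          (Finset.sum_le_sum fun K _ => measure_biUnion_finset_le _ _)
    _ ≤ ∑ K ∈ KK, ∑ A ∈ AA K,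
        ENNReal.ofReal (p ^ A.card * (((Real.exp 1 * (n * p)) ^ K.card)⁻¹ * (c * g K))) :=
        Finset.sum_le_sum fun K hK => Finset.sum_le_sum fun A hA => hE K hK A hA
    _ = ENNReal.ofReal (∑ K ∈ KK, ∑ A ∈ AA K,
          p ^ A.card * (((Real.exp 1 * (n * p)) ^ K.card)⁻¹ * (c * g K))) := by
        rw [ENNReal.ofReal_sum_of_nonneg]
        · refine Finset.sum_congr rfl fun K _ => ?_
          rw [ENNReal.ofReal_sum_of_nonneg]
          intro A _
          have := hgK K
          positivity
        · intro K _
          apply Finset.sum_nonneg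
          intro A _
          have := hgK K
          positivity
    _ ≤ ENNReal.ofReal (∑ K ∈ KK, c * g K) := by
        apply ENNReal.ofReal_le_ofReal
        apply Finset.sum_le_sum
        intro K hK
        rw [← Finset.sum_mul, ← mul_assoc]
        have h1 := sum_A_le (hitF d K) n K.card p hn0 hnp (hitF_card K (hKK K hK).2)
        have hpos : 0 < (Real.exp 1 * (n * p)) ^ K.card := by
          have : 0 < n * p := by linarith
          positivity
        have h2 : (∑ A ∈ AA K, p ^ A.card) * ((Real.exp 1 * (n * p)) ^ K.card)⁻¹ ≤ 1 := by
          rw [← div_eq_mul_inv, div_le_one hpos]; exact h1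
        calc _ ≤ 1 * (c * g K) := mul_le_mul_of_nonneg_right h2 (mul_nonneg hc0 (hgK K))
          _ = _ := one_mul _
    _ ≤ _ := by
        apply ENNReal.ofReal_le_ofReal
        rw [← Finset.mul_sum, mul_comm]
        gcongr

lemma bern_or (p p' : ℝ) (h0 : 0 ≤ p') (h1 : p' ≤ 1)
    (h : (1 - p') ^ 2 = 1 - max 0 (min p 1)) :
    bernoulliBool p = ((bernoulliBool p').prod (bernoulliBool p')).map (fun q => q.1 || q.2) := by
  have hm : Measurable (fun q : Bool × Bool => q.1 || q.2) := measurable_of_finite _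
  have : IsProbabilityMeasure (((bernoulliBool p').prod (bernoulliBool p')).map
    (fun q => q.1 || q.2)) := Measure.isProbabilityMeasure_map hm.aemeasurable
  have hf : bernoulliBool p {false} =
      ((bernoulliBool p').prod (bernoulliBool p')).map (fun q => q.1 || q.2) {false} := by
    rw [Measure.map_apply hm (measurableSet_singleton _)]
    have : (fun q : Bool × Bool => q.1 || q.2) ⁻¹' {false} = {false} ×ˢ {false} := by
      ext ⟨a, b⟩; cases a <;> cases b <;> simp
    rw [this, Measure.prod_prod, bern_false p' h0 h1, ← ENNReal.ofReal_mul (by linarith), ← sq, h]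
    simp [bernoulliBool]
  apply Measure.ext_of_singleton
  intro b
  cases b
  · exact hf
  · have : ({true} : Set Bool) = {false}ᶜ := by ext b; cases b <;> simp
    rw [this, prob_compl_eq_one_sub (measurableSet_singleton _),
      prob_compl_eq_one_sub (measurableSet_singleton _), hf]

lemma Y_or (n d : ℕ) (p p' : ℝ) (h0 : 0 ≤ p') (h1 : p' ≤ 1)
    (h : (1 - p') ^ 2 = 1 - max 0 (min p 1)) :
    YMeasure n d p = ((YMeasure n d p').prod (YMeasure n d p')).map
      (fun q i => q.1 i || q.2 i) := by
  have e := measurePreserving_arrowProdEquivProdArrow Bool Bool (FaceIdx n d)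
    (fun _ => bernoulliBool p') (fun _ => bernoulliBool p')
  unfold YMeasure
  rw [← e.map_eq, Measure.map_map (measurable_of_finite _) (measurable_of_finite _),
    bern_or p p' h0 h1 h]
  have hm : Measurable (fun q : Bool × Bool => q.1 || q.2) := measurable_of_finite _
  have := Measure.isProbabilityMeasure_map
    (μ := (bernoulliBool p').prod (bernoulliBool p')) hm.aemeasurable
  rw [← Measure.pi_map_pi (fun _ => hm.aemeasurable)]
  rfl

lemma fail_prob (n d : ℕ) (p p' : ℝ) (hd : 1 ≤ d) (hn : 4 * (d + 1) ^ 2 ≤ n)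
    (hL : 4 * ((d : ℝ) + 1) ^ 2 + ((d : ℝ) + 1) ^ 3 ≤ Real.log n)
    (hp : 40 * d * Real.log n / n ≤ p') (h0 : 0 ≤ p') (h1 : p' ≤ 1)
    (h : (1 - p') ^ 2 = 1 - max 0 (min p 1)) :
    YMeasure n d p {ω | ¬ HomologyZero (Ycomplex n d ω) (d - 1) ℤ} ≤
      ENNReal.ofReal (2 * Real.exp 2 / n) := by
  classical
  have hn0 : 0 < n := lt_of_lt_of_le (by positivity) hn
  have hnR : (1 : ℝ) ≤ n := by exact_mod_cast hn0
  set ε : ℝ := Real.exp 2 * ((n : ℝ) ^ (3 * d))⁻¹ with hε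
  have hε0 : 0 ≤ ε := by positivity
  have hprime : ∀ r : ℕ, r.Prime → YMeasure n d p' {Y | Bad n d (ZMod r) Y} ≤ ENNReal.ofReal ε := by
    intro r hr
    have := Fact.mk hr
    exact bad_prob n d p' hd hn hL hp h1 (ZMod r)
  rw [Y_or n d p p' h0 h1 h, Measure.map_apply (measurable_of_finite _) (Set.toFinite _).measurableSet]
  let B1 : Set ((FaceIdx n d → Bool) × (FaceIdx n d → Bool)) :=
    {Y | Bad n d (ZMod 2) Y} ×ˢ Set.univ
  let B2 : Set ((FaceIdx n d → Bool) × (FaceIdx n d → Bool)) :=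
    {q | ¬ Bad n d (ZMod 2) q.1 ∧ ∃ r : ℕ, r.Prime ∧ Bad n d (ZMod r) q.1 ∧ Bad n d (ZMod r) q.2}
  have hsub : (fun q : (FaceIdx n d → Bool) × (FaceIdx n d → Bool) => fun i => q.1 i || q.2 i) ⁻¹'
      {ω | ¬ HomologyZero (Ycomplex n d ω) (d - 1) ℤ} ⊆ B1 ∪ B2 := by
    rintro ⟨Y1, Y2⟩ hq
    by_contra hcon
    apply hq
    apply homologyZero_of_not_bad hd (⟨0, hn0⟩ : Fin n)
    intro r hr hb
    apply hcon
    have b1 : Bad n d (ZMod r) Y1 := Bad.mono (fun τ hτ => by simp [hτ]) hb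
    have b2 : Bad n d (ZMod r) Y2 := Bad.mono (fun τ hτ => by simp [hτ]) hb
    by_cases h2 : Bad n d (ZMod 2) Y1
    · left; exact ⟨h2, trivial⟩
    · right; exact ⟨h2, r, hr, b1, b2⟩
  have hB1 : ((YMeasure n d p').prod (YMeasure n d p')) B1 ≤ ENNReal.ofReal ε := by
    simp only [B1]
    rw [Measure.prod_prod, measure_univ, mul_one]
    exact hprime 2 Nat.prime_two
  have hB2 : ((YMeasure n d p').prod (YMeasure n d p')) B2 ≤ ENNReal.ofReal ((n : ℝ) ^ (2 * d) * ε) := by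
    rw [Measure.prod_apply (Set.toFinite _).measurableSet]
    have hx : ∀ Y1, YMeasure n d p' (Prod.mk Y1 ⁻¹' B2) ≤ ENNReal.ofReal ((n : ℝ) ^ (2 * d) * ε) := by
      intro Y1
      by_cases h2 : Bad n d (ZMod 2) Y1
      · have : Prod.mk Y1 ⁻¹' B2 = ∅ := by
          ext Y2
          simp [B2, h2]
        rw [this]; simp
      · obtain ⟨Q, hQ, hQ2⟩ := bad_primes (⟨0, hn0⟩ : Fin n) Y1 h2
        have hs : Prod.mk Y1 ⁻¹' B2 ⊆ ⋃ r ∈ Q.filter Nat.Prime, {Y | Bad n d (ZMod r) Y} := by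
          rintro Y2 ⟨_, r, hr, b1, b2⟩
          simp only [Set.mem_iUnion]
          exact ⟨r, by simp [hQ2 r hr b1, hr], b2⟩
        calc _ ≤ _ := measure_mono hs
          _ ≤ ∑ r ∈ Q.filter Nat.Prime, YMeasure n d p' {Y | Bad n d (ZMod r) Y} :=
            measure_biUnion_finset_le _ _
          _ ≤ ∑ r ∈ Q.filter Nat.Prime, ENNReal.ofReal ε :=
            Finset.sum_le_sum fun r hr => hprime r (Finset.mem_filter.mp hr).2
          _ = ((Q.filter Nat.Prime).card : ENNReal) * ENNReal.ofReal ε := by simp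
          _ = ENNReal.ofReal ((Q.filter Nat.Prime).card * ε) := by
            rw [ENNReal.ofReal_mul (Nat.cast_nonneg (Q.filter Nat.Prime).card), ENNReal.ofReal_natCast]
          _ ≤ _ := by
            apply ENNReal.ofReal_le_ofReal
            gcongr
            have : (Q.filter Nat.Prime).card ≤ n ^ (2 * d) := (Finset.card_filter_le _ _).trans hQ
            exact_mod_cast this
    calc _ ≤ ∫⁻ _, ENNReal.ofReal ((n : ℝ) ^ (2 * d) * ε) ∂(YMeasure n d p') := lintegral_mono hx
      _ = _ := by simp
  calc _ ≤ ((YMeasure n d p').prod (YMeasure n d p')) (B1 ∪ B2) := measure_mono hsub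
    _ ≤ _ := measure_union_le _ _
    _ ≤ ENNReal.ofReal ε + ENNReal.ofReal ((n : ℝ) ^ (2 * d) * ε) := add_le_add hB1 hB2
    _ = ENNReal.ofReal (ε + (n : ℝ) ^ (2 * d) * ε) := (ENNReal.ofReal_add hε0 (by positivity)).symm
    _ ≤ _ := by
      apply ENNReal.ofReal_le_ofReal
      have h2d : (1 : ℝ) ≤ (n : ℝ) ^ (2 * d) := one_le_pow₀ hnR
      have e1 : ε + (n : ℝ) ^ (2 * d) * ε ≤ 2 * ((n : ℝ) ^ (2 * d) * ε) := by nlinarith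
      have e2 : (n : ℝ) ^ (2 * d) * ε = Real.exp 2 * ((n : ℝ) ^ d)⁻¹ := by
        rw [hε, show 3 * d = 2 * d + d by ring, pow_add]
        field_simp
      have e3 : ((n : ℝ) ^ d)⁻¹ ≤ (n : ℝ)⁻¹ := by
        gcongr
        exact le_self_pow₀ hnR (by omega)
      calc _ ≤ _ := e1
        _ = 2 * (Real.exp 2 * ((n : ℝ) ^ d)⁻¹) := by rw [e2]
        _ ≤ 2 * (Real.exp 2 * (n : ℝ)⁻¹) := by gcongr
        _ = _ := by ring

noncomputable section
/-- **Vanishing of integer homology** (Hoffman–Kahle–Paquette). Fix `d ≥ 2`.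
If `p ≥ 80·d·log n / n` then w.h.p. `H_{d−1}(Y_d(n,p), ℤ) = 0`. -/
theorem integer_homology_vanishing (d : ℕ) (hd : 2 ≤ d) (p : ℕ → ℝ)
    (hp : ∀ n : ℕ, 80 * d * Real.log n / n ≤ p n) :
    Tendsto (fun n : ℕ => YMeasure n d (p n)
        {ω | HomologyZero (Ycomplex n d ω) (d - 1) ℤ})
      atTop (nhds (1 : ENNReal)) := by
  have hd0 : (0 : ℝ) < d := by
    have : 0 < d := by omega
    exact_mod_cast this
  have hlim : Tendsto (fun n : ℕ => (1 : ENNReal) - ENNReal.ofReal (2 * Real.exp 2 / n)) atTop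
      (nhds 1) := by
    have h1 : Tendsto (fun n : ℕ => ENNReal.ofReal (2 * Real.exp 2 / n)) atTop (nhds 0) := by
      rw [← ENNReal.ofReal_zero]
      exact ENNReal.tendsto_ofReal (tendsto_const_div_atTop_nhds_zero_nat _)
    have h2 := ENNReal.Tendsto.sub (tendsto_const_nhds (x := (1 : ENNReal)) (f := atTop (α := ℕ))) h1
      (Or.inl ENNReal.one_ne_top)
    simpa using h2
  have hlog1 : ∀ᶠ n : ℕ in atTop, 4 * ((d : ℝ) + 1) ^ 2 + ((d : ℝ) + 1) ^ 3 ≤ Real.log n :=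
    (Real.tendsto_log_atTop.comp tendsto_natCast_atTop_atTop).eventually_ge_atTop _
  have hlog2 : ∀ᶠ n : ℕ in atTop, ‖Real.log (n : ℝ)‖ ≤ (1 / (80 * d)) * ‖(n : ℝ)‖ :=
    tendsto_natCast_atTop_atTop.eventually
      (Real.isLittleO_log_id_atTop.def (by positivity : (0 : ℝ) < 1 / (80 * d)))
  refine tendsto_of_tendsto_of_tendsto_of_le_of_le' hlim tendsto_const_nhds ?_
    (Eventually.of_forall fun n => prob_le_one)
  filter_upwards [hlog1, hlog2, eventually_ge_atTop (4 * (d + 1) ^ 2)] with n hL hL2 hn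
  have hn0 : 0 < n := lt_of_lt_of_le (by positivity) hn
  have hnR : (0 : ℝ) < n := by exact_mod_cast hn0
  have hlogpos : 0 ≤ Real.log n := Real.log_natCast_nonneg n
  rw [Real.norm_of_nonneg hlogpos, Real.norm_of_nonneg hnR.le] at hL2
  set x : ℝ := 80 * d * Real.log n / n with hx
  have hx0 : 0 ≤ x := by positivity
  have hx1 : x ≤ 1 := by
    rw [hx, div_le_one hnR]
    calc 80 * d * Real.log n ≤ 80 * d * (1 / (80 * d) * n) := by gcongr
      _ = n := by field_simp
  set c : ℝ := max 0 (min (p n) 1) with hc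
  have hxc : x ≤ c := le_max_of_le_right (le_min (hp n) hx1)
  have hc1 : c ≤ 1 := by simp [hc]
  have hc0 : 0 ≤ c := hx0.trans hxc
  have hs2 : Real.sqrt (1 - c) ^ 2 = 1 - c := Real.sq_sqrt (by linarith)
  have hs0 := Real.sqrt_nonneg (1 - c)
  have hs1 : Real.sqrt (1 - c) ≤ 1 := by
    exact Real.sqrt_le_iff.mpr ⟨by norm_num, by linarith⟩
  have hs3 : Real.sqrt (1 - c) ≤ 1 - c / 2 := by
    apply Real.sqrt_le_iff.mpr
    constructor
    · linarith
    · nlinarith [sq_nonneg c]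
  have key := fail_prob n d (p n) (1 - Real.sqrt (1 - c)) (by omega) hn hL
    (by
      have : 40 * d * Real.log n / n = x / 2 := by rw [hx]; ring
      rw [this]; linarith) (by linarith) (by linarith) (by rw [sub_sub_cancel, hs2])
  have hcompl : {ω | ¬ HomologyZero (Ycomplex n d ω) (d - 1) ℤ} =
      {ω | HomologyZero (Ycomplex n d ω) (d - 1) ℤ}ᶜ := rfl
  rw [hcompl, prob_compl_eq_one_sub (Set.toFinite _).measurableSet] at key
  rw [tsub_le_iff_right] at key ⊢
  rwa [add_comm]
end
end

section
/- Fix d ≥ 1 and let G be a nontrivial abelian group, and let Y = Y_d(n,p). If p = p(n) satisfies n·p(n) → 0, then w.h.p. H_d(Y, G) = 0; and if n·p(n) → ∞ (and p(n) ≤ 1), then w.h.p. H_d(Y, G) ≠ 0. -/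
open MeasureTheory Filter Finset Matrix

namespace Koz

/-- clamped probability -/
def clamp (p : ℝ) : ℝ := max 0 (min p 1)

lemma clamp_nonneg (p : ℝ) : 0 ≤ clamp p := le_max_left _ _
lemma clamp_le_one (p : ℝ) : clamp p ≤ 1 := max_le zero_le_one (min_le_right _ _)

instance (p : ℝ) : IsProbabilityMeasure (bernoulliBool p) := by
  constructor
  simp only [bernoulliBool, Measure.add_apply, Measure.smul_apply, smul_eq_mul,
    measure_univ, mul_one]
  change ENNReal.ofReal (clamp p) + ENNReal.ofReal (1 - clamp p) = 1
  rw [← ENNReal.ofReal_add (clamp_nonneg p) (sub_nonneg.2 (clamp_le_one p))]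
  simp

instance (n d : ℕ) (p : ℝ) : IsProbabilityMeasure (YMeasure n d p) := by
  unfold YMeasure; infer_instance

lemma bern_true (p : ℝ) : bernoulliBool p {true} = ENNReal.ofReal (clamp p) := by
  simp [bernoulliBool, clamp]

/-- all sets of `F` are faces. -/
def AllIn {n d : ℕ} (ω : FaceIdx n d → Bool) (F : Finset (Finset (Fin n))) : Prop :=
  ∀ s ∈ F, ∃ h : s.card = d + 1, ω ⟨s, h⟩ = true

lemma prob_allIn (n d : ℕ) (p : ℝ) (F : Finset (Finset (Fin n))) :
    YMeasure n d p {ω | AllIn ω F} ≤ ENNReal.ofReal (clamp p) ^ F.card := by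
  classical
  by_cases hF : ∀ s ∈ F, s.card = d + 1
  · have h1 : {ω : FaceIdx n d → Bool | AllIn ω F} =
        Set.univ.pi (fun i : FaceIdx n d => if i.1 ∈ F then {true} else Set.univ) := by
      ext ω
      simp only [AllIn, Set.mem_ofPred_eq, Set.mem_pi, Set.mem_univ, forall_true_left]
      constructor
      · intro h i
        split_ifs with hi
        · obtain ⟨h', h2⟩ := h _ hi
          exact h2
        · trivial
      · intro h s hs
        refine ⟨hF s hs, ?_⟩
        have := h ⟨s, hF s hs⟩
        rw [if_pos hs] at this
        exact this
    rw [h1, YMeasure, Measure.pi_pi]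
    have h2 : ∀ i : FaceIdx n d, bernoulliBool p (if i.1 ∈ F then {true} else Set.univ)
        = if i.1 ∈ F then ENNReal.ofReal (clamp p) else 1 := by
      intro i
      split_ifs
      · exact bern_true p
      · exact measure_univ
    simp_rw [h2]
    rw [Finset.prod_ite, Finset.prod_const, Finset.prod_const_one, mul_one]
    apply le_of_eq
    congr 1
    refine Finset.card_bij (fun a _ => a.1) (by simp) (fun a _ b _ h => Subtype.ext h) ?_
    intro b hb
    exact ⟨⟨b, hF b hb⟩, by simpa using hb, rfl⟩
  · have : {ω : FaceIdx n d → Bool | AllIn ω F} = ∅ := by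
      ext ω
      simp only [Set.mem_ofPred_eq, Set.mem_empty_iff_false, iff_false]
      intro h
      exact hF fun s hs => (h s hs).1
    rw [this]; simp

/-- Exploration: `r` selects the ridge to be extended, `j` is the number of remaining
old-vertex steps. -/
inductive Ext {n d : ℕ} (r : Finset (Finset (Fin n)) → Finset (Fin n))
    (ω : FaceIdx n d → Bool) : Finset (Finset (Fin n)) → ℕ → Prop
  | zero (F) (h : AllIn ω F) : Ext r ω F 0
  | new (F j) (v : Fin n) (hr : r F ⊆ F.sup id) (hv : v ∉ F.sup id)
      (h : Ext r ω (insert (insert v (r F)) F) j) : Ext r ω F j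
  | old (F j) (v : Fin n) (hr : r F ⊆ F.sup id) (hv : v ∈ F.sup id)
      (hn : insert v (r F) ∉ F)
      (h : Ext r ω (insert (insert v (r F)) F) j) : Ext r ω F (j + 1)

lemma Ext.cases' {n d : ℕ} {r : Finset (Finset (Fin n)) → Finset (Fin n)}
    {ω : FaceIdx n d → Bool} {F j} (h : Ext r ω F (j + 1)) :
    (r F ⊆ F.sup id ∧ ∃ v, v ∉ F.sup id ∧ Ext r ω (insert (insert v (r F)) F) (j + 1)) ∨
    (r F ⊆ F.sup id ∧ ∃ v, v ∈ F.sup id ∧ insert v (r F) ∉ F ∧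
      Ext r ω (insert (insert v (r F)) F) j) := by
  cases h with
  | new _ _ v hr hv h => exact Or.inl ⟨hr, v, hv, h⟩
  | old _ _ v hr hv hn h => exact Or.inr ⟨hr, v, hv, hn, h⟩

lemma Ext.zero_allIn {n d : ℕ} {r : Finset (Finset (Fin n)) → Finset (Fin n)}
    {ω : FaceIdx n d → Bool} {F j} (h : Ext r ω F j) : AllIn ω F := by
  induction h with
  | zero F h => exact h
  | new F j v hr hv h ih => exact fun s hs => ih s (mem_insert_of_mem hs)
  | old F j v hr hv hn h ih => exact fun s hs => ih s (mem_insert_of_mem hs)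

open scoped ENNReal in
lemma prob_ext (n d : ℕ) (p : ℝ) (r : Finset (Finset (Fin n)) → Finset (Fin n))
    (J : ℕ) (hp : 2 * 2 ^ J * (n * clamp p) ≤ 1) :
    ∀ (N : ℕ) (F : Finset (Finset (Fin n))) (j : ℕ), j ≤ J → 1 ≤ (F.sup id).card →
      (n - (F.sup id).card) + j ≤ N →
      YMeasure n d p {ω | Ext r ω F j} ≤
        ENNReal.ofReal (clamp p ^ F.card * (2 * clamp p * (F.sup id).card) ^ j) := by
  have hq0 := clamp_nonneg p
  set q := clamp p with hq
  have hbase : ∀ F : Finset (Finset (Fin n)), YMeasure n d p {ω | Ext r ω F 0} ≤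
        ENNReal.ofReal (q ^ F.card * (2 * q * (F.sup id).card) ^ 0) := by
    intro F
    rw [pow_zero, mul_one, ENNReal.ofReal_pow hq0]
    refine le_trans (measure_mono ?_) (prob_allIn n d p F)
    intro ω h
    exact h.zero_allIn
  intro N
  induction N with
  | zero =>
    intro F j hj hv hN
    have : j = 0 := by omega
    subst this
    exact hbase F
  | succ N ih =>
    intro F j hj hv hN
    obtain _ | j := j
    · exact hbase F
    by_cases hr : r F ⊆ F.sup id
    swap
    · have : {ω : FaceIdx n d → Bool | Ext r ω F (j + 1)} = ∅ := by
        ext ω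
        simp only [Set.mem_ofPred_eq, Set.mem_empty_iff_false, iff_false]
        intro h
        rcases h.cases' with h | h <;> exact hr h.1
      rw [this]; simp
    set V := F.sup id with hV
    have hsub : {ω : FaceIdx n d → Bool | Ext r ω F (j + 1)} ⊆
        (⋃ v ∈ Vᶜ, {ω | Ext r ω (insert (insert v (r F)) F) (j + 1)}) ∪
        (⋃ v ∈ V.filter (fun v => insert v (r F) ∉ F),
          {ω | Ext r ω (insert (insert v (r F)) F) j}) := by
      intro ω h
      rcases h.cases' with ⟨_, v, hv, h⟩ | ⟨_, v, hv, hn, h⟩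
      · left
        simp only [Set.mem_iUnion]
        exact ⟨v, Finset.mem_compl.2 hv, h⟩
      · right
        simp only [Set.mem_iUnion]
        exact ⟨v, Finset.mem_filter.2 ⟨hv, hn⟩, h⟩
    have hnew : ∀ v ∈ Vᶜ, YMeasure n d p {ω | Ext r ω (insert (insert v (r F)) F) (j + 1)} ≤
        ENNReal.ofReal (q ^ (F.card + 1) * (2 * q * (V.card + 1 : ℕ)) ^ (j + 1)) := by
      intro v hv
      have hv' : v ∉ V := by simpa using hv
      have hnF : insert v (r F) ∉ F := fun h => hv' (by
        have : insert v (r F) ≤ V := Finset.le_sup (f := id) h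
        exact this (mem_insert_self _ _))
      have hs : (insert (insert v (r F)) F).sup id = insert v V := by
        rw [Finset.sup_insert, ← hV, id]
        ext x
        simp only [sup_eq_union, mem_union, mem_insert]
        constructor
        · rintro ((h | h) | h)
          · exact Or.inl h
          · exact Or.inr (hr h)
          · exact Or.inr h
        · tauto
      have hc : (insert v V).card = V.card + 1 := card_insert_of_notMem hv'
      have hle : (insert v V).card ≤ n := by simpa using Finset.card_le_univ (insert v V)
      have := ih (insert (insert v (r F)) F) (j + 1) hj (by rw [hs]; omega) (by rw [hs]; omega)
      rwa [hs, hc, card_insert_of_notMem hnF] at this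
    have hold : ∀ v ∈ V.filter (fun v => insert v (r F) ∉ F),
        YMeasure n d p {ω | Ext r ω (insert (insert v (r F)) F) j} ≤
        ENNReal.ofReal (q ^ (F.card + 1) * (2 * q * V.card) ^ j) := by
      intro v hv
      obtain ⟨hv', hnF⟩ := Finset.mem_filter.1 hv
      have hs : (insert (insert v (r F)) F).sup id = V := by
        rw [Finset.sup_insert, ← hV, id]
        exact sup_eq_right.2 (insert_subset hv' hr)
      have := ih (insert (insert v (r F)) F) j (by omega) (by rw [hs]; omega) (by rw [hs]; omega)
      rwa [hs, card_insert_of_notMem hnF] at this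
    refine (measure_mono hsub).trans ((measure_union_le _ _).trans ?_)
    have h1 : YMeasure n d p (⋃ v ∈ Vᶜ, {ω | Ext r ω (insert (insert v (r F)) F) (j + 1)}) ≤
        ENNReal.ofReal (n * (q ^ (F.card + 1) * (2 * q * (V.card + 1 : ℕ)) ^ (j + 1))) := by
      refine (measure_biUnion_finset_le _ _).trans ((Finset.sum_le_sum hnew).trans ?_)
      rw [Finset.sum_const, nsmul_eq_mul, ENNReal.ofReal_mul (Nat.cast_nonneg _),
        ENNReal.ofReal_natCast]
      gcongr
      simpa using Finset.card_le_univ Vᶜ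
    have h2 : YMeasure n d p (⋃ v ∈ V.filter (fun v => insert v (r F) ∉ F),
          {ω | Ext r ω (insert (insert v (r F)) F) j}) ≤
        ENNReal.ofReal (V.card * (q ^ (F.card + 1) * (2 * q * V.card) ^ j)) := by
      refine (measure_biUnion_finset_le _ _).trans ((Finset.sum_le_sum hold).trans ?_)
      rw [Finset.sum_const, nsmul_eq_mul, ENNReal.ofReal_mul (Nat.cast_nonneg _),
        ENNReal.ofReal_natCast]
      gcongr
      exact Finset.filter_subset _ _
    refine (add_le_add h1 h2).trans ?_
    rw [← ENNReal.ofReal_add (by positivity) (by positivity)]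
    apply ENNReal.ofReal_le_ofReal
    have hv1 : (1 : ℝ) ≤ V.card := by exact_mod_cast hv
    set c : ℝ := (V.card : ℝ)
    have e1 : (2 * q * ((V.card + 1 : ℕ) : ℝ)) ^ (j + 1) ≤ 2 ^ J * (2 * q * c) ^ (j + 1) := by
      have : (2 * q * ((V.card + 1 : ℕ) : ℝ)) ^ (j + 1) ≤ (2 * (2 * q * c)) ^ (j + 1) := by
        apply pow_le_pow_left₀ (by positivity)
        push_cast
        nlinarith
      refine this.trans ?_
      rw [mul_pow]
      gcongr
      · norm_num
    have e2 : (n : ℝ) * (q ^ (F.card + 1) * (2 * q * ((V.card + 1 : ℕ) : ℝ)) ^ (j + 1)) ≤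
        (1/2) * (q ^ F.card * (2 * q * c) ^ (j + 1)) := by
      calc _ ≤ (n : ℝ) * (q ^ (F.card + 1) * (2 ^ J * (2 * q * c) ^ (j + 1))) := by gcongr
        _ = (2 ^ J * (n * q)) * (q ^ F.card * (2 * q * c) ^ (j + 1)) := by ring
        _ ≤ _ := by
          apply mul_le_mul_of_nonneg_right _ (by positivity)
          linarith
    have e3 : c * (q ^ (F.card + 1) * (2 * q * c) ^ j) =
        (1/2) * (q ^ F.card * (2 * q * c) ^ (j + 1)) := by ring
    linarith

/-- `S` has no free ridge. -/
def Closed {n : ℕ} (d : ℕ) (S : Finset (Finset (Fin n))) : Prop :=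
  ∀ τ ∈ S, ∀ ρ ⊆ τ, ρ.card = d → ∃ τ' ∈ S, τ' ≠ τ ∧ ρ ⊆ τ'

/-- `ρ` is a free ridge of `F` -/
def Free {n : ℕ} (d : ℕ) (F : Finset (Finset (Fin n))) (ρ : Finset (Fin n)) : Prop :=
  ρ.card = d ∧ ∃ τ ∈ F, ρ ⊆ τ ∧ ∀ τ' ∈ F, ρ ⊆ τ' → τ' = τ

open Classical in
noncomputable def pick {n : ℕ} (d : ℕ) (F : Finset (Finset (Fin n))) : Finset (Fin n) :=
  if h : ∃ ρ, Free d F ρ then h.choose else ∅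

lemma pick_spec {n d : ℕ} {F : Finset (Finset (Fin n))} (h : ∃ ρ, Free d F ρ) :
    Free d F (pick d F) := by
  unfold pick
  rw [dif_pos h]
  exact h.choose_spec

lemma exists_free {n d : ℕ} {F : Finset (Finset (Fin n))} (hF : ∀ s ∈ F, s.card = d + 1)
    (w : Fin n) (hw : w ∈ F.sup id) (hdeg : (F.filter (fun s => w ∈ s)).card ≤ d) :
    ∃ ρ, Free d F ρ := by
  by_contra hno
  simp only [Free, not_exists, not_and, not_forall] at hno
  obtain ⟨τ, hτ, hwτ⟩ := Finset.mem_sup.1 hw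
  simp only [id] at hwτ
  have key : ∀ u ∈ τ.erase w, ∃ τ' ∈ F, τ.erase u ⊆ τ' ∧ τ' ≠ τ := by
    intro u hu
    have hu' := Finset.mem_of_mem_erase hu
    obtain ⟨τ', h1, h2, h3⟩ := hno (τ.erase u) (by rw [card_erase_of_mem hu', hF τ hτ]; rfl) τ hτ
      (erase_subset _ _)
    exact ⟨τ', h1, h2, h3⟩
  choose! g hg1 hg2 hg3 using key
  have hinj : Set.InjOn g (τ.erase w) := by
    intro u hu u' hu' h
    by_contra hne
    apply hg3 u hu
    symm
    apply Finset.eq_of_subset_of_card_le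
    · intro x hx
      by_cases hxu : x = u
      · subst hxu
        rw [h]
        exact hg2 u' hu' (Finset.mem_erase.2 ⟨hne, hx⟩)
      · exact hg2 u hu (Finset.mem_erase.2 ⟨hxu, hx⟩)
    · rw [hF _ (hg1 u hu), hF τ hτ]
  have hsub : insert τ ((τ.erase w).image g) ⊆ F.filter (fun s => w ∈ s) := by
    intro s hs
    rcases Finset.mem_insert.1 hs with rfl | hs
    · exact Finset.mem_filter.2 ⟨hτ, hwτ⟩
    · obtain ⟨u, hu, rfl⟩ := Finset.mem_image.1 hs
      refine Finset.mem_filter.2 ⟨hg1 u hu, hg2 u hu ?_⟩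
      exact Finset.mem_erase.2 ⟨(Finset.ne_of_mem_erase hu).symm, hwτ⟩
  have hc := Finset.card_le_card hsub
  rw [card_insert_of_notMem, Finset.card_image_of_injOn hinj, card_erase_of_mem hwτ, hF τ hτ] at hc
  · omega
  · intro h
    obtain ⟨u, hu, h⟩ := Finset.mem_image.1 h
    exact hg3 u hu h

lemma ext_of_closed {n d : ℕ} (ω : FaceIdx n d → Bool) (S : Finset (Finset (Fin n)))
    (hS : AllIn ω S) (hcl : Closed d S) :
    ∀ (N : ℕ) (F : Finset (Finset (Fin n))) (j : ℕ) (w : Fin n), F ⊆ S → (S \ F).card ≤ N →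
      w ∈ F.sup id → (F.filter (fun s => w ∈ s)).card + j ≤ d + 1 → Ext (pick d) ω F j := by
  intro N
  induction N with
  | zero =>
    intro F j w hFS hN hw hdeg
    obtain _ | j := j
    · exact Ext.zero F fun s hs => hS s (hFS hs)
    exfalso
    obtain ⟨hc, τ, hτ, h1, h2⟩ := pick_spec (exists_free (fun s hs => (hS s (hFS hs)).1) w hw (by omega))
    obtain ⟨τ', h3, h4, h5⟩ := hcl τ (hFS hτ) _ h1 hc
    have : S \ F = ∅ := by simpa using hN
    have h6 : τ' ∈ F := by
      by_contra h
      have : τ' ∈ S \ F := Finset.mem_sdiff.2 ⟨h3, h⟩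
      rw [‹S \ F = ∅›] at this
      exact absurd this (Finset.notMem_empty _)
    exact h4 (h2 _ h6 h5)
  | succ N ih =>
    intro F j w hFS hN hw hdeg
    obtain _ | j := j
    · exact Ext.zero F fun s hs => hS s (hFS hs)
    obtain ⟨hc, τ, hτ, h1, h2⟩ := pick_spec (exists_free (fun s hs => (hS s (hFS hs)).1) w hw (by omega))
    obtain ⟨τ', h3, h4, h5⟩ := hcl τ (hFS hτ) _ h1 hc
    have h6 : τ' ∉ F := fun h => h4 (h2 _ h h5)
    have hr : pick d F ⊆ F.sup id := h1.trans (Finset.le_sup (f := id) hτ)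
    obtain ⟨v, hv, hvτ⟩ : ∃ v, v ∉ pick d F ∧ insert v (pick d F) = τ' := by
      have hcard := (hS τ' h3).1
      have : pick d F ⋖ τ' := by
        rw [Finset.covBy_iff_card_sdiff_eq_one]
        refine ⟨h5, ?_⟩
        rw [card_sdiff_of_subset h5]; omega
      exact (Finset.covBy_iff_exists_insert.1 this)
    have hF'S : insert τ' F ⊆ S := insert_subset h3 hFS
    have hN' : (S \ insert τ' F).card ≤ N := by
      have : (S \ insert τ' F).card < (S \ F).card := by
        apply Finset.card_lt_card
        refine ⟨sdiff_subset_sdiff le_rfl (subset_insert _ _), fun h => ?_⟩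
        have := h (Finset.mem_sdiff.2 ⟨h3, h6⟩)
        simp at this
      omega
    by_cases hvV : v ∈ F.sup id
    · refine Ext.old F j v hr hvV (by rwa [hvτ]) ?_
      rw [hvτ]
      refine ih _ j w hF'S hN' ?_ ?_
      · rw [Finset.sup_insert]
        exact Finset.mem_union_right _ hw
      · have : ((insert τ' F).filter (fun s => w ∈ s)).card ≤ (F.filter (fun s => w ∈ s)).card + 1 := by
          rw [Finset.filter_insert]
          split_ifs
          · exact card_insert_le _ _
          · omega
        omega
    · refine Ext.new F (j + 1) v hr hvV ?_
      rw [hvτ]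
      refine ih _ (j + 1) v hF'S hN' ?_ ?_
      · rw [Finset.sup_insert, ← hvτ]
        exact Finset.mem_union_left _ (mem_insert_self _ _)
      · have : (insert τ' F).filter (fun s => v ∈ s) ⊆ {τ'} := by
          intro s hs
          obtain ⟨hs1, hs2⟩ := Finset.mem_filter.1 hs
          rcases Finset.mem_insert.1 hs1 with rfl | hs1
          · simp
          · exact absurd (Finset.mem_sup.2 ⟨s, hs1, hs2⟩) hvV
        have := Finset.card_le_card this
        have h7 := Finset.card_pos.2 ⟨w, hw⟩
        have h8 : 1 ≤ (F.filter (fun s => w ∈ s)).card := by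
          obtain ⟨s, hs, hws⟩ := Finset.mem_sup.1 hw
          exact Finset.card_pos.2 ⟨s, Finset.mem_filter.2 ⟨hs, hws⟩⟩
        simp at this
        omega

lemma exists_closed {n d : ℕ} (ω : FaceIdx n d → Bool) (G : Type) [AddCommGroup G]
    (h : ¬ TopHomologyZero (Ycomplex n d ω) d G) :
    ∃ S : Finset (Finset (Fin n)), S.Nonempty ∧ AllIn ω S ∧ Closed d S := by
  classical
  unfold TopHomologyZero at h
  push Not at h
  obtain ⟨f, hf, hne⟩ := h
  refine ⟨(Finset.univ.filter fun s => f s ≠ 0).map (Function.Embedding.subtype _), ?_, ?_, ?_⟩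
  · obtain ⟨s, hs⟩ := Function.ne_iff.1 hne
    exact ⟨s.1, by simpa using ⟨s.2, hs⟩⟩
  · intro s hs
    simp only [Finset.mem_map, mem_filter, mem_univ, true_and] at hs
    obtain ⟨a, ha, rfl⟩ := hs
    have := a.2
    simp only [Ycomplex, mem_filter, mem_univ, true_and] at this
    rcases this with ⟨h | h, h'⟩
    · omega
    · exact h
  · intro τ hτ ρ hρ hc
    simp only [Finset.mem_map, mem_filter, mem_univ, true_and] at hτ
    obtain ⟨a, ha, rfl⟩ := hτ
    simp only [Function.Embedding.subtype_apply] at *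
    obtain ⟨v, hv, hvτ⟩ : ∃ v, v ∉ ρ ∧ insert v ρ = a.1 := by
      have hcard := a.2.2
      have : ρ ⋖ a.1 := by
        rw [Finset.covBy_iff_card_sdiff_eq_one]
        refine ⟨hρ, ?_⟩
        rw [card_sdiff_of_subset hρ]; omega
      exact (Finset.covBy_iff_exists_insert.1 this)
    have hρK : ρ ∈ Ycomplex n d ω := by simp [Ycomplex, hc]
    have hb := congrFun hf ⟨ρ, hρK, hc⟩
    simp only [chainBoundary, Pi.zero_apply] at hb
    by_contra hno
    push Not at hno
    rw [Finset.sum_eq_single v] at hb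
    · have hcond : v ∉ ρ ∧ insert v ρ ∈ Ycomplex n d ω := ⟨hv, by rw [hvτ]; exact a.2.1⟩
      rw [dif_pos hcond] at hb
      have h0 : f ⟨insert v ρ, hcond.2, by rw [hvτ]; exact a.2.2⟩ ≠ 0 := by
        have : (⟨insert v ρ, hcond.2, by rw [hvτ]; exact a.2.2⟩ :
          {s : Finset (Fin n) // s ∈ Ycomplex n d ω ∧ s.card = d + 1}) = a := Subtype.ext hvτ
        rw [this]; exact ha
      rcases neg_one_pow_eq_or ℤ (ρ.filter (fun u => u < v)).card with h | h
      · rw [h] at hb; simp at hb; exact h0 hb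
      · rw [h] at hb; simp at hb; exact h0 hb
    · intro u _ hu
      split_ifs with hcond
      · by_cases hz : f ⟨insert u ρ, hcond.2, by rw [card_insert_of_notMem hcond.1, hc]⟩ = 0
        · rw [hz, smul_zero]
        · exfalso
          refine hno (insert u ρ) ?_ ?_ (subset_insert _ _)
          · simp only [Finset.mem_map, mem_filter, mem_univ, true_and]
            exact ⟨_, hz, rfl⟩
          · rw [← hvτ]
            intro h
            have : u ∈ insert v ρ := h ▸ mem_insert_self u ρ
            rcases Finset.mem_insert.1 this with h | h
            · exact hu h
            · exact hcond.1 h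
      · rfl
    · simp

lemma prob_bad (n d : ℕ) (p : ℝ) (G : Type) [AddCommGroup G]
    (hp : 2 * 2 ^ d * (n * clamp p) ≤ 1) :
    YMeasure n d p {ω | TopHomologyZero (Ycomplex n d ω) d G}ᶜ ≤
      ENNReal.ofReal ((2 * (d + 1)) ^ d * (n * clamp p) ^ (d + 1)) := by
  classical
  have hq0 := clamp_nonneg p
  have hsub : {ω | TopHomologyZero (Ycomplex n d ω) d G}ᶜ ⊆
      ⋃ A ∈ Finset.powersetCard (d + 1) (Finset.univ : Finset (Fin n)),
        {ω : FaceIdx n d → Bool | Ext (pick d) ω {A} d} := by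
    intro ω h
    obtain ⟨S, ⟨A, hA⟩, hS, hcl⟩ := exists_closed ω G h
    simp only [Set.mem_iUnion]
    have hAc := (hS A hA).1
    refine ⟨A, by simpa using hAc, ?_⟩
    obtain ⟨w, hw⟩ : A.Nonempty := Finset.card_pos.1 (by omega)
    refine ext_of_closed ω S hS hcl _ {A} d w (by simpa using hA) le_rfl (by simpa using hw) ?_
    have := Finset.card_filter_le {A} (fun s => w ∈ s)
    simp only [card_singleton] at this
    omega
  refine (measure_mono hsub).trans ((measure_biUnion_finset_le _ _).trans ?_)
  have hb : ∀ A ∈ Finset.powersetCard (d + 1) (Finset.univ : Finset (Fin n)),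
      YMeasure n d p {ω : FaceIdx n d → Bool | Ext (pick d) ω {A} d} ≤
      ENNReal.ofReal (clamp p * (2 * clamp p * (d + 1)) ^ d) := by
    intro A hA
    have hAc : A.card = d + 1 := by simpa using hA
    have := prob_ext n d p (pick d) d hp _ {A} d le_rfl (by simp [hAc]) le_rfl
    simpa [hAc] using this
  refine (Finset.sum_le_sum hb).trans ?_
  rw [Finset.sum_const, nsmul_eq_mul, card_powersetCard, Finset.card_univ, Fintype.card_fin,
    ← ENNReal.ofReal_natCast, ← ENNReal.ofReal_mul (by positivity)]
  apply ENNReal.ofReal_le_ofReal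
  calc ((n.choose (d + 1) : ℕ) : ℝ) * (clamp p * (2 * clamp p * (d + 1)) ^ d)
      ≤ (n : ℝ) ^ (d + 1) * (clamp p * (2 * clamp p * (d + 1)) ^ d) := by
        gcongr
        exact_mod_cast Nat.choose_le_pow n (d + 1)
    _ = _ := by simp only [mul_pow, pow_succ]; ring

lemma part1 (d : ℕ) (G : Type) [AddCommGroup G] (p : ℕ → ℝ)
    (h : Tendsto (fun n : ℕ => (n : ℝ) * p n) atTop (nhds 0)) :
      Tendsto (fun n : ℕ => YMeasure n d (p n)
          {ω | TopHomologyZero (Ycomplex n d ω) d G})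
        atTop (nhds (1 : ENNReal)) := by
  have h1 : Tendsto (fun n : ℕ => (n : ℝ) * clamp (p n)) atTop (nhds 0) := by
    have h2 := h.abs
    rw [abs_zero] at h2
    refine squeeze_zero (fun n => mul_nonneg (Nat.cast_nonneg _) (clamp_nonneg _)) (fun n => ?_) h2
    rw [abs_mul, Nat.abs_cast]
    gcongr
    exact max_le (abs_nonneg _) ((min_le_left _ _).trans (le_abs_self _))
  have h3 : Tendsto (fun n : ℕ => YMeasure n d (p n)
      {ω | TopHomologyZero (Ycomplex n d ω) d G}ᶜ) atTop (nhds 0) := by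
    have h4 : Tendsto (fun n : ℕ => ENNReal.ofReal
        ((2 * (d + 1)) ^ d * (n * clamp (p n)) ^ (d + 1))) atTop (nhds 0) := by
      have := ENNReal.tendsto_ofReal ((h1.pow (d + 1)).const_mul ((2 * ((d:ℝ) + 1)) ^ d))
      simpa using this
    refine tendsto_of_tendsto_of_tendsto_of_le_of_le' tendsto_const_nhds h4
      (Eventually.of_forall fun _ => zero_le) ?_
    have h5 : ∀ᶠ n : ℕ in atTop, 2 * 2 ^ d * ((n : ℝ) * clamp (p n)) < 1 := by
      have := (h1.const_mul (2 * 2 ^ d : ℝ))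
      rw [mul_zero] at this
      exact this.eventually_lt_const one_pos
    filter_upwards [h5] with n hn
    exact prob_bad n d (p n) G hn.le
  have h6 : ∀ n, YMeasure n d (p n) {ω | TopHomologyZero (Ycomplex n d ω) d G} =
      1 - YMeasure n d (p n) {ω | TopHomologyZero (Ycomplex n d ω) d G}ᶜ := by
    intro n
    rw [← prob_compl_eq_one_sub (MeasurableSet.of_discrete), compl_compl]
  simp_rw [h6]
  have := ENNReal.Tendsto.sub (tendsto_const_nhds (x := (1 : ENNReal))) h3 (by simp)
  simpa using this

lemma boundary_map {n : ℕ} (K : Finset (Finset (Fin n))) (c : ℕ) {A B : Type}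
    [AddCommGroup A] [AddCommGroup B] (φ : A →+ B) (f : Chains K (c + 1) A) :
    chainBoundary K c (fun τ => φ (f τ)) = fun ρ => φ (chainBoundary K c f ρ) := by
  funext ρ
  simp only [chainBoundary]
  rw [map_sum]
  refine Finset.sum_congr rfl fun v _ => ?_
  split_ifs
  · rw [map_zsmul]
  · simp

lemma exists_int_cycle {n : ℕ} (K : Finset (Finset (Fin n))) (c : ℕ)
    (h0 : 0 < Fintype.card {s : Finset (Fin n) // s ∈ K ∧ s.card = c})
    (h : Fintype.card {s : Finset (Fin n) // s ∈ K ∧ s.card = c} <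
      Fintype.card {s : Finset (Fin n) // s ∈ K ∧ s.card = c + 1}) :
    ∃ t : Chains K (c + 1) ℤ, t ≠ 0 ∧ chainBoundary K c t = 0 := by
  let A : Matrix {s : Finset (Fin n) // s ∈ K ∧ s.card = c}
      {s : Finset (Fin n) // s ∈ K ∧ s.card = c + 1} ℤ := fun ρ τ =>
    ∑ v : Fin n, if v ∉ ρ.1 ∧ insert v ρ.1 = τ.1 then
      (-1 : ℤ) ^ (ρ.1.filter (fun u => u < v)).card else 0
  obtain ⟨t, ht, hA, -⟩ := Int.Matrix.exists_ne_zero_int_vec_norm_le A h h0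
  refine ⟨t, ht, ?_⟩
  rw [← hA]
  funext ρ
  simp only [chainBoundary, Matrix.mulVec, dotProduct, A]
  simp_rw [Finset.sum_mul]
  rw [Finset.sum_comm]
  refine Finset.sum_congr rfl fun v _ => ?_
  split_ifs with hv
  · rw [Finset.sum_eq_single ⟨insert v ρ.1, hv.2, by rw [Finset.card_insert_of_notMem hv.1, ρ.2.2]⟩]
    · rw [if_pos ⟨hv.1, rfl⟩, smul_eq_mul]
    · intro τ _ hτ
      rw [if_neg, zero_mul]
      rintro ⟨_, h⟩
      exact hτ (Subtype.ext h.symm)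
    · simp
  · symm
    apply Finset.sum_eq_zero
    intro τ _
    rw [if_neg, zero_mul]
    rintro ⟨h1, h2⟩
    exact hv ⟨h1, h2 ▸ τ.2.1⟩

lemma not_topZero {n : ℕ} (K : Finset (Finset (Fin n))) (c : ℕ)
    (G : Type) [AddCommGroup G] [Nontrivial G]
    (h0 : 0 < Fintype.card {s : Finset (Fin n) // s ∈ K ∧ s.card = c})
    (h : Fintype.card {s : Finset (Fin n) // s ∈ K ∧ s.card = c} <
      Fintype.card {s : Finset (Fin n) // s ∈ K ∧ s.card = c + 1}) :
    ¬ TopHomologyZero K c G := by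
  intro hz
  obtain ⟨t, ht, hb⟩ := exists_int_cycle K c h0 h
  obtain ⟨τ0, hτ0⟩ := Function.ne_iff.1 ht
  obtain ⟨u, hu, hgcd⟩ := Finset.extract_gcd (s := Finset.univ) t ⟨τ0, mem_univ _⟩
  set a := (Finset.univ : Finset {s : Finset (Fin n) // s ∈ K ∧ s.card = c + 1}).gcd t
  have ha : a ≠ 0 := by
    intro ha
    apply hτ0
    rw [hu τ0 (mem_univ _), ha]; simp
  have hbu : chainBoundary K c u = 0 := by
    have h1 : t = fun τ => AddMonoidHom.mulLeft a (u τ) := by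
      funext τ
      exact hu τ (mem_univ _)
    rw [h1, boundary_map] at hb
    funext ρ
    have := congrFun hb ρ
    simpa [ha] using this
  obtain ⟨g, hg⟩ := exists_ne (0 : G)
  have h2 : (fun τ => (zmultiplesHom G g) (u τ) : Chains K (c + 1) G) = 0 := by
    apply hz
    rw [boundary_map, hbu]
    funext ρ
    simp
  have h3 : (addOrderOf g : ℤ) ∣ 1 := by
    rw [← hgcd]
    apply Finset.dvd_gcd
    intro τ _
    rw [addOrderOf_dvd_iff_zsmul_eq_zero]
    exact congrFun h2 τ
  have h4 : addOrderOf g = 1 := by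
    have := Int.natCast_dvd_natCast.1 (by simpa using h3 : ((addOrderOf g : ℕ) : ℤ) ∣ ((1 : ℕ) : ℤ))
    exact Nat.dvd_one.1 this
  exact hg (AddMonoid.addOrderOf_eq_one_iff.1 h4)

lemma card_ridges {n d : ℕ} (ω : FaceIdx n d → Bool) :
    Fintype.card {s : Finset (Fin n) // s ∈ Ycomplex n d ω ∧ s.card = d} = n.choose d := by
  rw [Fintype.card_subtype]
  have : (Finset.univ.filter fun s : Finset (Fin n) => s ∈ Ycomplex n d ω ∧ s.card = d) =
      Finset.powersetCard d Finset.univ := by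
    ext s
    simp only [Ycomplex, mem_filter, mem_univ, true_and, mem_powersetCard, subset_univ]
    constructor
    · exact fun h => h.2
    · exact fun h => ⟨Or.inl h.le, h⟩
  rw [this, card_powersetCard]; simp

lemma card_faces {n d : ℕ} (ω : FaceIdx n d → Bool) :
    Fintype.card {s : Finset (Fin n) // s ∈ Ycomplex n d ω ∧ s.card = d + 1} =
      (Finset.univ.filter fun i => ω i = true).card := by
  rw [← Fintype.card_subtype]
  refine Fintype.card_congr ⟨fun s => ⟨⟨s.1, s.2.2⟩, ?_⟩, fun i => ⟨i.1.1, ?_, i.1.2⟩,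
    fun _ => rfl, fun _ => rfl⟩
  · obtain ⟨s, hs, hc⟩ := s
    simp only [Ycomplex, mem_filter, mem_univ, true_and] at hs
    rcases hs with h | ⟨_, h⟩
    · omega
    · exact h
  · simp only [Ycomplex, mem_filter, mem_univ, true_and]
    exact Or.inr ⟨i.1.2, i.2⟩

lemma integral_bern (p : ℝ) :
    ∫ b, (if b = true then (1/2 : ℝ) else 1) ∂(bernoulliBool p) = 1 - clamp p / 2 := by
  have h0 := clamp_nonneg p
  have h1 := clamp_le_one p
  rw [bernoulliBool, integral_add_measure, integral_smul_measure, integral_smul_measure,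
    integral_dirac, integral_dirac]
  · change (ENNReal.ofReal (clamp p)).toReal • _ + (ENNReal.ofReal (1 - clamp p)).toReal • _ = _
    rw [ENNReal.toReal_ofReal h0, ENNReal.toReal_ofReal (by linarith)]
    simp
    ring
  · exact (Integrable.of_finite).smul_measure (by simp)
  · exact (Integrable.of_finite).smul_measure (by simp)

lemma chernoff (n d C : ℕ) (p : ℝ) :
    (YMeasure n d p).real {ω | (Finset.univ.filter fun i => ω i = true).card ≤ C} ≤
      2 ^ C * (1 - clamp p / 2) ^ (n.choose (d + 1)) := by
  have hint : ∫ ω, ∏ i, (if ω i = true then (1/2 : ℝ) else 1) ∂(YMeasure n d p) =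
      (1 - clamp p / 2) ^ (n.choose (d + 1)) := by
    rw [YMeasure, integral_fintype_prod_eq_pow (fun b => if b = true then (1/2 : ℝ) else 1),
      integral_bern]
    congr 1
    simp
  have hm := mul_meas_ge_le_integral_of_nonneg (μ := YMeasure n d p)
    (f := fun ω => ∏ i, (if ω i = true then (1/2 : ℝ) else 1))
    (Eventually.of_forall fun ω => Finset.prod_nonneg fun i _ => by split_ifs <;> norm_num)
    Integrable.of_finite ((1/2) ^ C)
  rw [hint] at hm
  have hsub : {ω : FaceIdx n d → Bool | (Finset.univ.filter fun i => ω i = true).card ≤ C} ⊆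
      {ω | (1/2 : ℝ) ^ C ≤ ∏ i, (if ω i = true then (1/2 : ℝ) else 1)} := by
    intro ω h
    change (1/2 : ℝ) ^ C ≤ ∏ i, (if ω i = true then (1/2 : ℝ) else 1)
    rw [Finset.prod_ite, Finset.prod_const, Finset.prod_const_one, mul_one]
    exact pow_le_pow_of_le_one (by norm_num) (by norm_num) h
  have h1 := measureReal_mono (μ := YMeasure n d p) hsub
  refine h1.trans ?_
  have h2 : (2 : ℝ) ^ C * (1/2) ^ C = 1 := by rw [← mul_pow]; norm_num
  calc _ = 2 ^ C * ((1/2) ^ C * (YMeasure n d p).real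
        {ω | (1/2 : ℝ) ^ C ≤ ∏ i, (if ω i = true then (1/2 : ℝ) else 1)}) := by
        rw [← mul_assoc, h2, one_mul]
    _ ≤ _ := by gcongr

lemma prob_bad2 (n d : ℕ) (p : ℝ) (G : Type) [AddCommGroup G] [Nontrivial G]
    (hn : 2 * d + 1 ≤ n) (hp : 8 * (d + 1) ≤ n * clamp p) :
    YMeasure n d p {ω | ¬ TopHomologyZero (Ycomplex n d ω) d G}ᶜ ≤
      ENNReal.ofReal (Real.exp (-(n * clamp p / (8 * (d + 1))))) := by
  have h0 := clamp_nonneg p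
  have h1 := clamp_le_one p
  set q := clamp p with hq
  have hC : 0 < n.choose d := Nat.choose_pos (by omega)
  have hsub : {ω | ¬ TopHomologyZero (Ycomplex n d ω) d G}ᶜ ⊆
      {ω | (Finset.univ.filter fun i => ω i = true).card ≤ n.choose d} := by
    intro ω h
    change (Finset.univ.filter fun i => ω i = true).card ≤ n.choose d
    by_contra hlt
    apply h
    refine not_topZero _ d G ?_ ?_
    · rwa [card_ridges]
    · rw [card_ridges, card_faces]; omega
  refine (measure_mono hsub).trans ?_
  rw [← ofReal_measureReal]
  apply ENNReal.ofReal_le_ofReal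
  refine (chernoff n d _ p).trans ?_
  rw [← hq]
  have hN : ((n.choose (d + 1) : ℕ) : ℝ) * (d + 1) = (n.choose d : ℕ) * (n - d) := by
    have := Nat.choose_succ_right_eq n d
    have h3 : ((n - d : ℕ) : ℝ) = n - d := Nat.cast_sub (by omega)
    rw [← h3]
    exact_mod_cast this
  set N := n.choose (d + 1)
  set C := n.choose d
  have hC1 : (1 : ℝ) ≤ C := by exact_mod_cast hC
  have hnd : (n : ℝ) / 2 ≤ n - d := by
    have : (2 * d + 1 : ℝ) ≤ n := by exact_mod_cast hn
    linarith
  have hd0 : (0 : ℝ) < d + 1 := by positivity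
  have key : (C : ℝ) * (n * q) / 2 ≤ N * q * (d + 1) := by
    have : (N : ℝ) * q * (d + 1) = C * ((n - d) * q) := by linear_combination q * hN
    rw [this]
    have : (n : ℝ) / 2 * q ≤ (n - d) * q := by gcongr
    nlinarith
  have k1 : 4 * (C : ℝ) ≤ N * q := by
    have : (C : ℝ) * (8 * (d + 1)) ≤ C * (n * q) := by gcongr
    nlinarith
  have k2 : n * q / (8 * (d + 1)) ≤ N * q / 4 := by
    rw [div_le_div_iff₀ (by positivity) (by norm_num)]
    have : 1 * (n * q) ≤ (C : ℝ) * (n * q) := by gcongr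
    nlinarith
  have e1 : (2 : ℝ) ^ C ≤ Real.exp C := by
    have : (2 : ℝ) ≤ Real.exp 1 := by
      have := Real.add_one_le_exp 1
      linarith
    calc (2 : ℝ) ^ C ≤ (Real.exp 1) ^ C := by gcongr
      _ = _ := by rw [← Real.exp_nat_mul, mul_one]
  have e2 : (1 - q / 2) ^ N ≤ Real.exp (-(N * q / 2)) := by
    have : 1 - q / 2 ≤ Real.exp (-(q/2)) := by
      have := Real.add_one_le_exp (-(q/2))
      linarith
    calc (1 - q / 2) ^ N ≤ (Real.exp (-(q/2))) ^ N := by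
          apply pow_le_pow_left₀ (by linarith) this
      _ = _ := by rw [← Real.exp_nat_mul]; congr 1; ring
  calc (2 : ℝ) ^ C * (1 - q / 2) ^ N ≤ Real.exp C * Real.exp (-(N * q / 2)) := by
        apply mul_le_mul e1 e2 _ (Real.exp_pos _).le
        apply pow_nonneg; linarith
    _ = Real.exp (C + -(N * q / 2)) := by rw [Real.exp_add]
    _ ≤ _ := by
      apply Real.exp_le_exp.2
      linarith

lemma part2 (d : ℕ) (G : Type) [AddCommGroup G] [Nontrivial G] (p : ℕ → ℝ)
    (hp : ∀ n, p n ≤ 1)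
    (h : Tendsto (fun n : ℕ => (n : ℝ) * p n) atTop atTop) :
      Tendsto (fun n : ℕ => YMeasure n d (p n)
          {ω | ¬ TopHomologyZero (Ycomplex n d ω) d G})
        atTop (nhds (1 : ENNReal)) := by
  have h1 : Tendsto (fun n : ℕ => (n : ℝ) * clamp (p n)) atTop atTop := by
    refine tendsto_atTop_mono (fun n => ?_) h
    gcongr
    exact (le_min le_rfl (hp n)).trans (le_max_right _ _)
  have h3 : Tendsto (fun n : ℕ => YMeasure n d (p n)
      {ω | ¬ TopHomologyZero (Ycomplex n d ω) d G}ᶜ) atTop (nhds 0) := by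
    have h4 : Tendsto (fun n : ℕ => ENNReal.ofReal
        (Real.exp (-(n * clamp (p n) / (8 * (d + 1)))))) atTop (nhds 0) := by
      have := ENNReal.tendsto_ofReal (Real.tendsto_exp_neg_atTop_nhds_zero.comp
        (h1.atTop_div_const (r := 8 * ((d : ℝ) + 1)) (by positivity)))
      simpa using this
    refine tendsto_of_tendsto_of_tendsto_of_le_of_le' tendsto_const_nhds h4
      (Eventually.of_forall fun _ => zero_le) ?_
    filter_upwards [h1.eventually_ge_atTop (8 * ((d : ℝ) + 1)), eventually_ge_atTop (2 * d + 1)]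
      with n hn hn'
    exact prob_bad2 n d (p n) G hn' hn
  have h6 : ∀ n, YMeasure n d (p n) {ω | ¬ TopHomologyZero (Ycomplex n d ω) d G} =
      1 - YMeasure n d (p n) {ω | ¬ TopHomologyZero (Ycomplex n d ω) d G}ᶜ := by
    intro n
    rw [← prob_compl_eq_one_sub (MeasurableSet.of_discrete), compl_compl]
  simp_rw [h6]
  have := ENNReal.Tendsto.sub (tendsto_const_nhds (x := (1 : ENNReal))) h3 (by simp)
  simpa using this

end Koz

noncomputable section
/-- **The birth of top-dimensional cycles** (Kozlov). Fix `d ≥ 1` and a nontrivial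
abelian group `G`. If `np → 0` then w.h.p. `H_d(Y_d(n,p), G) = 0`, and if
`np → ∞` (with `p ≤ 1`) then w.h.p. `H_d(Y_d(n,p), G) ≠ 0`. -/
theorem kozlov_top_homology (d : ℕ) (hd : 1 ≤ d)
    (G : Type) [AddCommGroup G] [Nontrivial G] (p : ℕ → ℝ) :
    (Tendsto (fun n : ℕ => (n : ℝ) * p n) atTop (nhds 0) →
      Tendsto (fun n : ℕ => YMeasure n d (p n)
          {ω | TopHomologyZero (Ycomplex n d ω) d G})
        atTop (nhds (1 : ENNReal))) ∧
    ((∀ n : ℕ, p n ≤ 1) → Tendsto (fun n : ℕ => (n : ℝ) * p n) atTop atTop →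
      Tendsto (fun n : ℕ => YMeasure n d (p n)
          {ω | ¬ TopHomologyZero (Ycomplex n d ω) d G})
        atTop (nhds (1 : ENNReal))) := by
  exact ⟨Koz.part1 d G p, Koz.part2 d G p⟩
end
end
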